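/- Let S be a set of primes with natural density δ(S), and let a : ℕ → ℂ satisfy a(1) = 1, a(n) = 0 unless n = 1 or p_min(n) ∈ S, and ∑_{n ≥ 2, p_min(n) ∈ S} |a(n)| (log log n)/n < ∞. Then −lim_{x→∞} ∑_{2 ≤ n ≤ x, p_min(n) ∈ S} (μ * a)(n)/n = δ(S), where μ * a is the Dirichlet convolution. -/

import Mathlib

namespace AL
section tauberian
open MeasureTheory
open scoped FourierTransform

open Complex in
theorem taub1 (h : ℝ → ℂ) (hm : Measurable h) (B : ℝ) (hB : ∀ t, ‖h t‖ ≤ B) (G : ℂ → ℂ)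
    (hG : ContinuousOn G {z | 0 ≤ z.re})
    (hL : ∀ z : ℂ, 0 < z.re → ∫ t in Set.Ioi (0:ℝ), h t * Complex.exp (-z * t) = G z)
    (φ : SchwartzMap ℝ ℂ) (hφ : HasCompactSupport φ) :
    Filter.Tendsto (fun x : ℝ => ∫ t in Set.Ioi (0:ℝ), h t * (𝓕 φ) (t - x)) Filter.atTop (nhds 0) := by
  have hB0 : 0 ≤ B := (norm_nonneg _).trans (hB 0)
  -- Fubini
  have key : ∀ x σ : ℝ, 0 < σ → ∫ t in Set.Ioi (0:ℝ), h t * Complex.exp (-σ * t) * (𝓕 φ) (t - x)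
      = ∫ y : ℝ, Complex.exp (2 * Real.pi * y * x * I) * (φ y * G (σ + 2 * Real.pi * y * I)) := by
    intro x σ hσ
    have e1 : ∀ t : ℝ, h t * Complex.exp (-σ * t) * (𝓕 φ) (t - x) =
        ∫ y : ℝ, (h t * Complex.exp (-σ * t)) * (Complex.exp (-2 * Real.pi * y * (t - x) * I) * φ y) := by
      intro t
      rw [integral_const_mul, SchwartzMap.fourier_coe, Real.fourier_eq']
      congr 2
      ext y
      simp only [smul_eq_mul, RCLike.inner_apply, conj_trivial]
      congr 2
      push_cast
      ring
    simp_rw [e1]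
    have hint1 : Integrable (fun t : ℝ => h t * Complex.exp (-σ * t)) (volume.restrict (Set.Ioi 0)) := by
      have : Integrable (fun t : ℝ => B * Real.exp (-σ * t)) (volume.restrict (Set.Ioi 0)) :=
        (integrableOn_exp_mul_Ioi (by linarith) 0).const_mul B
      refine this.mono' ?_ ?_
      · exact (hm.mul (by fun_prop)).aestronglyMeasurable
      · filter_upwards with t
        rw [norm_mul, Complex.norm_exp]
        simp only [neg_mul, neg_re, mul_re, ofReal_re, ofReal_im, mul_zero, sub_zero]
        exact mul_le_mul_of_nonneg_right (hB t) (Real.exp_pos _).le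
    rw [integral_integral_swap]
    · congr 1
      ext y
      rw [← hL _ (by simpa using hσ)]
      rw [← integral_const_mul, ← integral_const_mul]
      congr 1
      ext t
      have : Complex.exp (-2 * Real.pi * y * (t - x) * I) * Complex.exp (-σ * t) =
        Complex.exp (2 * Real.pi * y * x * I) * Complex.exp (-(σ + 2 * Real.pi * y * I) * t) := by
        rw [← Complex.exp_add, ← Complex.exp_add]
        congr 1
        ring
      linear_combination (h t * φ y) * this
    · have := hint1.mul_prod (φ.integrable (μ := volume))
      refine this.mono ?_ ?_
      · refine AEStronglyMeasurable.mul ?_ (AEStronglyMeasurable.mul ?_ ?_)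
        · exact (((hm.comp measurable_fst).mul (by fun_prop))).aestronglyMeasurable
        · exact (by fun_prop : Continuous fun p : ℝ × ℝ => Complex.exp (-2 * Real.pi * p.2 * (p.1 - x) * I)).aestronglyMeasurable
        · exact (φ.continuous.comp continuous_snd).aestronglyMeasurable
      · filter_upwards with p
        simp only [Function.uncurry, norm_mul]
        rw [Complex.norm_exp (-2 * _ * _ * _ * _)]
        simp
  -- limit
  have key2 : ∀ x : ℝ, ∫ t in Set.Ioi (0:ℝ), h t * (𝓕 φ) (t - x)
      = ∫ y : ℝ, Complex.exp (2 * Real.pi * y * x * I) * (φ y * G (2 * Real.pi * y * I)) := by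
    intro x
    let s : ℕ → ℝ := fun n => 1 / ((n:ℝ) + 1)
    have hs0 : ∀ n, 0 < s n := fun n => by positivity
    have hs1 : ∀ n, s n ≤ 1 := fun n => by
      simp only [s]; rw [div_le_one (by positivity)]; linarith [(Nat.cast_nonneg n : (0:ℝ) ≤ n)]
    have hs : Filter.Tendsto s Filter.atTop (nhds 0) := tendsto_one_div_add_atTop_nhds_zero_nat
    have l1 : Filter.Tendsto (fun n => ∫ t in Set.Ioi (0:ℝ), h t * Complex.exp (-(s n : ℝ) * t) * (𝓕 φ) (t - x))
        Filter.atTop (nhds (∫ t in Set.Ioi (0:ℝ), h t * (𝓕 φ) (t - x))) := by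
      apply tendsto_integral_of_dominated_convergence (fun t => B * ‖(𝓕 φ) (t - x)‖)
      · intro n
        exact ((hm.mul (by fun_prop)).mul ((𝓕 φ).continuous.measurable.comp (by fun_prop))).aestronglyMeasurable
      · exact (((𝓕 φ).integrable (μ := volume)).comp_sub_right x).norm.const_mul B |>.integrableOn
      · intro n
        filter_upwards [ae_restrict_mem measurableSet_Ioi] with t ht
        rw [norm_mul, norm_mul, Complex.norm_exp]
        have : Real.exp (-(s n : ℝ) * t) ≤ 1 := by
          rw [Real.exp_le_one_iff]
          have := hs0 n
          have := mul_pos this ht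
          linarith
        simp only [neg_mul, neg_re, mul_re, ofReal_re, ofReal_im, mul_zero, sub_zero] at this ⊢
        have h2 := mul_le_mul (hB t) this (Real.exp_pos _).le hB0
        rw [mul_one] at h2
        exact mul_le_mul_of_nonneg_right h2 (norm_nonneg _)
      · filter_upwards with t
        have : Filter.Tendsto (fun n => Complex.exp (-(s n : ℝ) * t)) Filter.atTop (nhds (Complex.exp (-(0:ℝ) * t))) := by
          have hc : Continuous (fun u : ℝ => Complex.exp (-u * t)) := by fun_prop
          exact (hc.tendsto 0).comp hs
        simp only [ofReal_zero, neg_zero, zero_mul, Complex.exp_zero] at this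
        simpa using (this.const_mul (h t)).mul_const ((𝓕 φ) (t - x))
    have l2 : Filter.Tendsto (fun n => ∫ y : ℝ, Complex.exp (2 * Real.pi * y * x * I) * (φ y * G ((s n : ℝ) + 2 * Real.pi * y * I)))
        Filter.atTop (nhds (∫ y : ℝ, Complex.exp (2 * Real.pi * y * x * I) * (φ y * G (2 * Real.pi * y * I)))) := by
      have hcont : ContinuousOn (fun p : ℝ × ℝ => G (p.1 + 2 * Real.pi * p.2 * I)) (Set.Icc 0 1 ×ˢ tsupport φ) := by
        apply hG.comp (by fun_prop)
        rintro ⟨a, b⟩ ⟨ha, hb⟩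
        simpa using ha.1
      obtain ⟨C, hC⟩ := (isCompact_Icc.prod hφ.isCompact).exists_bound_of_continuousOn hcont
      apply tendsto_integral_of_dominated_convergence (fun y => ‖φ y‖ * C)
      · intro n
        have hc : Continuous fun y : ℝ => G ((s n : ℝ) + 2 * Real.pi * y * I) := by
          apply hG.comp_continuous (by fun_prop)
          intro y
          simpa using (hs0 n).le
        have hc2 : Continuous fun y : ℝ => Complex.exp (2 * Real.pi * y * x * I) := by fun_prop
        exact (hc2.mul (φ.continuous.mul hc)).aestronglyMeasurable
      · exact (φ.integrable (μ := volume)).norm.mul_const C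
      · intro n
        filter_upwards with y
        rw [norm_mul, norm_mul, Complex.norm_exp]
        have : Real.exp (2 * Real.pi * y * x * I : ℂ).re = 1 := by simp
        rw [this, one_mul]
        by_cases hy : y ∈ tsupport φ
        · exact mul_le_mul_of_nonneg_left (hC (s n, y) ⟨⟨(hs0 n).le, hs1 n⟩, hy⟩) (norm_nonneg _)
        · simp [image_eq_zero_of_notMem_tsupport hy]
      · filter_upwards with y
        apply Filter.Tendsto.const_mul
        apply Filter.Tendsto.const_mul
        have h1 : Filter.Tendsto (fun n => ((s n : ℝ) + 2 * Real.pi * y * I : ℂ)) Filter.atTop (nhdsWithin (2 * Real.pi * y * I) {z | 0 ≤ z.re}) := by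
          rw [tendsto_nhdsWithin_iff]
          constructor
          · have hc : Continuous (fun u : ℝ => (u + 2 * Real.pi * y * I : ℂ)) := by fun_prop
            have := (hc.tendsto 0).comp hs
            simpa [Function.comp_def] using this
          · filter_upwards with n
            simpa using (hs0 n).le
        exact (hG _ (by simp)).tendsto.comp h1
    refine tendsto_nhds_unique l1 (l2.congr fun n => ?_)
    rw [key x _ (hs0 n)]
  simp_rw [key2]
  have RL := Real.tendsto_integral_exp_smul_cocompact (fun y : ℝ => φ y * G (2 * Real.pi * y * I))
  have hneg : Filter.Tendsto (fun x : ℝ => -x) Filter.atTop (Filter.cocompact ℝ) :=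
    Filter.tendsto_neg_atTop_atBot.mono_right atBot_le_cocompact
  refine (RL.comp hneg).congr fun x => ?_
  simp only [Function.comp]
  congr 1
  ext y
  rw [Circle.smul_def, Real.fourierChar_apply, smul_eq_mul]
  congr 2
  push_cast
  ring

theorem exists_phi : ∃ φ : SchwartzMap ℝ ℂ, HasCompactSupport φ ∧ φ 0 = 1 := by
  let b : ContDiffBump (0:ℝ) := default
  have h1 : HasCompactSupport (fun x => (b x : ℂ)) := b.hasCompactSupport.comp_left (g := fun x : ℝ => (x:ℂ)) (by simp)
  have h2 : ContDiff ℝ (⊤ : ℕ∞) (fun x => (b x : ℂ)) := Complex.ofRealCLM.contDiff.comp b.contDiff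
  refine ⟨h1.toSchwartzMap h2, ?_, ?_⟩
  · exact h1
  · show ((b 0 : ℝ) : ℂ) = 1
    rw [b.one_of_mem_closedBall (by simp [b.rIn_pos.le])]; simp

theorem integral_fourier (φ : SchwartzMap ℝ ℂ) : ∫ t, (𝓕 φ) t = φ 0 := by
  have h : 𝓕⁻ (𝓕 φ) = φ := FourierTransform.fourierInv_fourier_eq φ
  have h2 : (𝓕⁻ (𝓕 φ)) 0 = φ 0 := by rw [h]
  rw [← h2, SchwartzMap.fourierInv_coe, Real.fourierInv_eq']
  simp

theorem taub2 (φ : SchwartzMap ℝ ℂ) (hφ : HasCompactSupport φ) (h01 : φ 0 = 1)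
    (h : ℝ → ℂ) (hm : Measurable h) (hB : ∀ t, ‖h t‖ ≤ 1) (h0 : ∀ t ≤ 0, h t = 0) (G : ℂ → ℂ)
    (hG : ContinuousOn G {z | 0 ≤ z.re})
    (hL : ∀ z : ℂ, 0 < z.re → ∫ t in Set.Ioi (0:ℝ), h t * Complex.exp (-z * t) = G z)
    (L : ℝ) (hL0 : 0 ≤ L) (e : ℝ → ℝ) (he : Filter.Tendsto e Filter.atTop (nhds 0))
    (hosc : ∀ x > 0, ∀ u, x / 2 ≤ x + u → ‖h x - h (x + u)‖ ≤ L * |u| + e x) :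
    ∀ ε > 0, ∀ᶠ x in Filter.atTop, ‖h x‖ ≤ L * (∫ u, |u| * ‖(𝓕 φ) u‖) + ε := by
  have T := taub1 h hm 1 hB G hG hL φ hφ
  set ψ := 𝓕 φ with hψ
  have hi0 : Integrable (fun u => ‖ψ u‖) := ψ.integrable.norm
  have hi1 : Integrable (fun u : ℝ => |u| * ‖ψ u‖) := by
    simpa using ψ.integrable_pow_mul volume 1
  set C1 := ∫ u : ℝ, |u| * ‖ψ u‖ with hC1
  set C0 := ∫ u : ℝ, ‖ψ u‖ with hC0
  -- main inequality
  have main : ∀ x > 0, ‖h x - ∫ t in Set.Ioi (0:ℝ), h t * ψ (t - x)‖ ≤ L * C1 + (4 / x) * C1 + |e x| * C0 := by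
    intro x hx
    have e1 : ∫ t in Set.Ioi (0:ℝ), h t * ψ (t - x) = ∫ u, h (x + u) * ψ u := by
      rw [← integral_indicator measurableSet_Ioi]
      rw [← integral_add_left_eq_self (μ := volume) _ x]
      congr 1
      ext u
      by_cases hu : 0 < x + u
      · rw [Set.indicator_of_mem (by exact hu)]; simp
      · rw [Set.indicator_of_notMem (by exact hu), h0 _ (not_lt.mp hu)]; simp
    have e2 : h x = ∫ u, h x * ψ u := by
      rw [integral_const_mul, hψ, integral_fourier, h01, mul_one]
    have i1 : Integrable (fun u => h x * ψ u) := ψ.integrable.const_mul _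
    have i2 : Integrable (fun u => h (x + u) * ψ u) := by
      refine ψ.integrable.mono ((hm.comp (by fun_prop)).mul ψ.continuous.measurable).aestronglyMeasurable ?_
      filter_upwards with u
      rw [norm_mul]
      exact mul_le_of_le_one_left (norm_nonneg _) (hB _)
    rw [e1]
    nth_rewrite 1 [e2]
    rw [← integral_sub i1 i2]
    have e3 : L * C1 + (4 / x) * C1 + |e x| * C0 = ∫ u, (L * (|u| * ‖ψ u‖) + (4 / x) * (|u| * ‖ψ u‖) + |e x| * ‖ψ u‖) := by
      rw [integral_add, integral_add, integral_const_mul, integral_const_mul, integral_const_mul]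
      · exact hi1.const_mul _
      · exact hi1.const_mul _
      · exact (hi1.const_mul _).add (hi1.const_mul _)
      · exact hi0.const_mul _
    rw [e3]
    refine norm_integral_le_of_norm_le (((hi1.const_mul _).add (hi1.const_mul _)).add (hi0.const_mul _)) ?_
    filter_upwards with u
    rw [← sub_mul, norm_mul]
    have : ‖h x - h (x + u)‖ ≤ L * |u| + 4 / x * |u| + |e x| := by
      by_cases hu : x / 2 ≤ x + u
      · have h1 := hosc x hx u hu
        have h2 := le_abs_self (e x)
        have h3 : 0 ≤ 4 / x * |u| := by positivity
        linarith
      · push Not at hu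
        have h1 : ‖h x - h (x + u)‖ ≤ 2 := by
          have := norm_sub_le (h x) (h (x+u))
          linarith [hB x, hB (x+u)]
        have h2 : x / 2 ≤ |u| := by
          rw [abs_of_neg (by linarith)]; linarith
        have h3 : 2 ≤ 4 / x * |u| := by
          rw [div_mul_eq_mul_div, le_div_iff₀ hx]; linarith
        have : 0 ≤ L * |u| := by positivity
        linarith [abs_nonneg (e x)]
    calc _ ≤ (L * |u| + 4 / x * |u| + |e x|) * ‖ψ u‖ := mul_le_mul_of_nonneg_right this (norm_nonneg _)
      _ = _ := by ring
  intro ε hε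
  have t1 : Filter.Tendsto (fun x : ℝ => (4 / x) * C1 + |e x| * C0 + ‖∫ t in Set.Ioi (0:ℝ), h t * ψ (t - x)‖) Filter.atTop (nhds 0) := by
    have a1 : Filter.Tendsto (fun x : ℝ => (4 / x) * C1) Filter.atTop (nhds 0) := by
      simpa using (tendsto_const_nhds.div_atTop Filter.tendsto_id (a := (4:ℝ))).mul_const C1
    have a2 : Filter.Tendsto (fun x : ℝ => |e x| * C0) Filter.atTop (nhds 0) := by
      simpa using he.abs.mul_const C0
    simpa using (a1.add a2).add T.norm
  filter_upwards [t1.eventually (ge_mem_nhds hε), Filter.eventually_gt_atTop 0] with x hx hx0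
  have := main x hx0
  have h4 := norm_sub_norm_le (h x) (∫ t in Set.Ioi (0:ℝ), h t * ψ (t - x))
  linarith

/-- Mertens function. -/
noncomputable def Mf (n : ℕ) : ℂ := ∑ k ∈ Finset.Icc 1 n, ((ArithmeticFunction.moebius k : ℤ) : ℂ)

theorem norm_mu_le (k : ℕ) : ‖((ArithmeticFunction.moebius k : ℤ) : ℂ)‖ ≤ 1 := by
  rw [Complex.norm_intCast]
  exact_mod_cast ArithmeticFunction.abs_moebius_le_one

theorem Mf_diff {a b : ℕ} (h : a ≤ b) : ‖Mf b - Mf a‖ ≤ (b:ℝ) - a := by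
  have : Mf b = Mf a + ∑ k ∈ Finset.Ioc a b, ((ArithmeticFunction.moebius k : ℤ) : ℂ) := by
    unfold Mf
    rw [← Finset.sum_union]
    · congr 1
      ext x; simp; omega
    · rw [Finset.disjoint_left]; intro x; simp; omega
  rw [this, add_sub_cancel_left]
  calc _ ≤ ∑ k ∈ Finset.Ioc a b, (1:ℝ) := norm_sum_le_of_le _ fun k _ => norm_mu_le k
    _ = _ := by simp [Nat.cast_sub h]

theorem Mf_le (a : ℕ) : ‖Mf a‖ ≤ a := by
  have := Mf_diff (Nat.zero_le a)
  simpa [Mf] using this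

/-- normalized. -/
noncomputable def H (t : ℝ) : ℂ := if 0 < t then Mf ⌊Real.exp t⌋₊ * Real.exp (-t) else 0

theorem H_meas : Measurable H := by
  unfold H
  refine Measurable.ite measurableSet_Ioi ?_ measurable_const
  refine Measurable.mul ?_ (by fun_prop)
  exact (measurable_from_top (f := Mf)).comp (Nat.measurable_floor.comp (by fun_prop))

theorem H_bd (t : ℝ) : ‖H t‖ ≤ 1 := by
  unfold H
  split_ifs with h
  · rw [norm_mul, Complex.norm_real, Real.norm_of_nonneg (Real.exp_pos _).le]
    calc _ ≤ Real.exp t * Real.exp (-t) := by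
          gcongr
          exact (Mf_le _).trans (Nat.floor_le (Real.exp_pos _).le)
      _ = 1 := by rw [← Real.exp_add]; simp
  · simp

theorem H_osc1 {s t : ℝ} (hs : 0 < s) (hst : s ≤ t) : ‖H t - H s‖ ≤ 2 * (t - s) + Real.exp (-s) := by
  unfold H
  rw [if_pos hs, if_pos (hs.trans_le hst)]
  have e1 : Mf ⌊Real.exp t⌋₊ * Real.exp (-t) - Mf ⌊Real.exp s⌋₊ * Real.exp (-s) =
    (Mf ⌊Real.exp t⌋₊ - Mf ⌊Real.exp s⌋₊) * Real.exp (-t) - Mf ⌊Real.exp s⌋₊ * ((Real.exp (-s) - Real.exp (-t) : ℝ) : ℂ) := by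
    push_cast; ring
  rw [e1]
  refine (norm_sub_le _ _).trans ?_
  rw [norm_mul, norm_mul, Complex.norm_real, Complex.norm_real, Real.norm_of_nonneg (Real.exp_pos _).le]
  have hle : Real.exp (-t) ≤ Real.exp (-s) := Real.exp_le_exp.mpr (by linarith)
  rw [Real.norm_of_nonneg (by linarith)]
  have hfl : ⌊Real.exp s⌋₊ ≤ ⌊Real.exp t⌋₊ := Nat.floor_mono (Real.exp_le_exp.mpr hst)
  have h1 : ‖Mf ⌊Real.exp t⌋₊ - Mf ⌊Real.exp s⌋₊‖ ≤ Real.exp t - Real.exp s + 1 := by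
    have := Mf_diff hfl
    have h2 := Nat.floor_le (Real.exp_pos t).le
    have h3 := Nat.lt_floor_add_one (Real.exp s)
    linarith
  have h2 : ‖Mf ⌊Real.exp s⌋₊‖ ≤ Real.exp s := (Mf_le _).trans (Nat.floor_le (Real.exp_pos _).le)
  have e2 : Real.exp t * Real.exp (-t) = 1 := by rw [← Real.exp_add]; simp
  have e3 : Real.exp s * Real.exp (-s) = 1 := by rw [← Real.exp_add]; simp
  have e4 : Real.exp s * Real.exp (-t) = Real.exp (s - t) := by rw [← Real.exp_add]; congr 1
  have e5 := Real.add_one_le_exp (s - t)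
  have := mul_le_mul_of_nonneg_right h1 (Real.exp_pos (-t)).le
  have := mul_le_mul_of_nonneg_right h2 (sub_nonneg.mpr hle)
  nlinarith

theorem H_osc (x : ℝ) (hx : 0 < x) (u : ℝ) (hu : x / 2 ≤ x + u) :
    ‖H x - H (x + u)‖ ≤ 2 * |u| + Real.exp (-(x/2)) := by
  rcases le_total 0 u with h | h
  · rw [norm_sub_rev]
    have := H_osc1 hx (show x ≤ x + u by linarith)
    have h2 : Real.exp (-x) ≤ Real.exp (-(x/2)) := Real.exp_le_exp.mpr (by linarith)
    rw [abs_of_nonneg h]; linarith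
  · have := H_osc1 (s := x + u) (t := x) (by linarith) (by linarith)
    have h2 : Real.exp (-(x+u)) ≤ Real.exp (-(x/2)) := Real.exp_le_exp.mpr (by linarith)
    rw [abs_of_nonpos h]; linarith

/-- continuation. -/
noncomputable def G (z : ℂ) : ℂ := Function.update (fun s => (riemannZeta s)⁻¹) 1 0 (1 + z) / (1 + z)

theorem G_cont : ContinuousOn G {z | 0 ≤ z.re} := by
  intro z hz
  have hz' : 0 ≤ z.re := hz
  apply ContinuousAt.continuousWithinAt
  unfold G
  have hne : 1 + z ≠ 0 := by
    intro h
    have := congrArg Complex.re h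
    simp at this; linarith
  refine ContinuousAt.div ?_ (by fun_prop) hne
  have : ContinuousAt (Function.update (fun s => (riemannZeta s)⁻¹) 1 0) (1 + z) := by
    by_cases h : 1 + z = 1
    · rw [h, continuousAt_update_same]
      have h1 := riemannZeta_residue_one.inv₀ one_ne_zero
      have h2 : Filter.Tendsto (fun s : ℂ => s - 1) (nhdsWithin 1 {1}ᶜ) (nhds 0) := by
        have : Continuous (fun s : ℂ => s - 1) := by fun_prop
        have := (this.tendsto 1).mono_left (nhdsWithin_le_nhds (s := {1}ᶜ))
        simpa using this
      have h3 := h2.mul h1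
      rw [zero_mul] at h3
      refine h3.congr' ?_
      filter_upwards [self_mem_nhdsWithin] with s hs
      have : s - 1 ≠ 0 := sub_ne_zero.mpr hs
      field_simp
    · rw [continuousAt_update_of_ne h]
      exact (differentiableAt_riemannZeta h).continuousAt.inv₀
        (riemannZeta_ne_zero_of_one_le_re (by simpa using hz'))
  exact ContinuousAt.comp (f := fun z => 1 + z) (x := z) this (by fun_prop)

open Complex in
theorem H_laplace (z : ℂ) (hz : 0 < z.re) :
    ∫ t in Set.Ioi (0:ℝ), H t * Complex.exp (-z * t) = G z := by
  have hs : (1:ℝ) < (1 + z).re := by simpa using hz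
  have h1 := LSeries_eq_mul_integral' (fun n => ((ArithmeticFunction.moebius n : ℤ) : ℂ)) (r := 1) zero_le_one (s := 1 + z) hs (by
    refine Asymptotics.isBigO_of_le _ fun n => ?_
    rw [Real.rpow_one, Real.norm_of_nonneg (by positivity), Real.norm_of_nonneg (by positivity)]
    calc _ ≤ ∑ k ∈ Finset.Icc 1 n, (1:ℝ) := Finset.sum_le_sum fun k _ => norm_mu_le k
      _ = n := by simp)
  have hne : 1 + z ≠ 0 := by
    intro h
    have := congrArg Complex.re h
    simp at this; linarith
  have hne1 : 1 + z ≠ 1 := by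
    intro h
    have := congrArg Complex.re h
    simp at this; linarith
  have h2 := ArithmeticFunction.LSeries_zeta_mul_Lseries_moebius hs
  rw [ArithmeticFunction.LSeries_zeta_eq_riemannZeta hs] at h2
  have h3 : LSeries (fun n => ((ArithmeticFunction.moebius n : ℤ) : ℂ)) (1 + z) = (riemannZeta (1+z))⁻¹ :=
    eq_inv_of_mul_eq_one_right h2
  unfold G
  rw [Function.update_of_ne hne1, ← h3, h1, mul_div_cancel_left₀ _ hne]
  have h4 := integral_comp_exp_Ioi (fun t : ℝ => (∑ k ∈ Finset.Icc 1 ⌊t⌋₊, ((ArithmeticFunction.moebius k : ℤ) : ℂ)) * (t:ℂ) ^ (-(1 + z + 1))) 0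
  rw [Real.exp_zero] at h4
  rw [← h4]
  apply setIntegral_congr_fun measurableSet_Ioi
  intro t ht
  have ht' : 0 < t := ht
  simp only [H, if_pos ht', Mf, Complex.real_smul]
  have : ((Real.exp t : ℝ) : ℂ) ^ (-(1 + z + 1)) = Complex.exp (-(1 + z + 1) * t) := by
    rw [Complex.cpow_def_of_ne_zero (by exact_mod_cast (Real.exp_pos t).ne'), ← Complex.ofReal_log (Real.exp_pos t).le, Real.log_exp, mul_comm]
  rw [this]
  have e : Complex.exp (-t) * Complex.exp (-z * t) = Complex.exp t * Complex.exp (-(1 + z + 1) * t) := by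
    rw [← Complex.exp_add, ← Complex.exp_add]; congr 1; ring
  push_cast
  linear_combination (∑ k ∈ Finset.Icc 1 ⌊Real.exp t⌋₊, ((ArithmeticFunction.moebius k : ℤ) : ℂ)) * e

theorem H_tendsto : Filter.Tendsto H Filter.atTop (nhds 0) := by
  obtain ⟨φ, hφ, h01⟩ := exists_phi
  set C := ∫ u, |u| * ‖(𝓕 φ) u‖ with hC
  have hC0 : 0 ≤ C := integral_nonneg fun u => by positivity
  rw [Metric.tendsto_atTop']
  intro ε hε
  obtain ⟨l, hl0, hl⟩ : ∃ l : ℝ, 0 < l ∧ 2 / l * C < ε / 2 := by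
    refine ⟨4 * (C + 1) / ε, by positivity, ?_⟩
    rw [div_div_eq_mul_div, div_mul_eq_mul_div, div_lt_div_iff₀ (by positivity) (by positivity)]
    nlinarith
  have := taub2 φ hφ h01 (fun t => H (l⁻¹ * t)) (H_meas.comp (by fun_prop)) (fun t => H_bd _) (by
      intro t ht
      have : ¬ 0 < l⁻¹ * t := by
        rw [not_lt]; exact mul_nonpos_of_nonneg_of_nonpos (by positivity) ht
      simp [H, this]) (fun z => l * G (l * z)) (by
      refine continuousOn_const.mul (G_cont.comp (by fun_prop) ?_)
      intro z hz
      have : 0 ≤ z.re := hz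
      simp only [Set.mem_ofPred_eq, Complex.mul_re, Complex.ofReal_re, Complex.ofReal_im]
      simpa using by positivity) (by
      intro z hz
      rw [← H_laplace _ (by simpa using by positivity)]
      have := integral_comp_mul_left_Ioi (fun t : ℝ => H t * Complex.exp (-(l * z) * t)) 0 (inv_pos.mpr hl0)
      rw [mul_zero, inv_inv, Complex.real_smul] at this
      rw [← this]
      congr 1
      ext t
      congr 2
      have : (l:ℂ) ≠ 0 := by exact_mod_cast hl0.ne'
      push_cast
      field_simp) (2 / l) (by positivity) (fun x => Real.exp (-(l⁻¹ * x / 2))) (by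
      apply Real.tendsto_exp_neg_atTop_nhds_zero.comp
      exact (Filter.tendsto_id.const_mul_atTop (inv_pos.mpr hl0)).atTop_div_const (by norm_num)) (by
      intro x hx u hu
      have := H_osc (l⁻¹ * x) (by positivity) (l⁻¹ * u) (by
        have := mul_le_mul_of_nonneg_left hu (inv_pos.mpr hl0).le
        linarith)
      rw [mul_add]
      rw [abs_mul, abs_of_pos (inv_pos.mpr hl0)] at this
      convert this using 2
      ring) (ε/2) (by positivity)
  obtain ⟨N, hN⟩ := Filter.eventually_atTop.mp this
  refine ⟨l⁻¹ * N, fun t ht => ?_⟩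
  have h5 := hN (l * t) (by
    have := mul_lt_mul_of_pos_left ht hl0
    rw [mul_inv_cancel_left₀ hl0.ne'] at this
    exact this.le)
  simp only [inv_mul_cancel_left₀ hl0.ne'] at h5
  rw [dist_zero_right]
  linarith

theorem Mf_tendsto : Filter.Tendsto (fun n : ℕ => Mf n / n) Filter.atTop (nhds 0) := by
  have h := H_tendsto.comp (Real.tendsto_log_atTop.comp tendsto_natCast_atTop_atTop)
  refine h.congr' ?_
  filter_upwards [Filter.eventually_ge_atTop 2] with n hn
  have hn' : (1:ℝ) < n := by exact_mod_cast hn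
  simp only [Function.comp, H, if_pos (Real.log_pos hn'), Real.exp_neg, Real.exp_log (by linarith : (0:ℝ) < n), Nat.floor_natCast]
  push_cast
  rfl

end tauberian

section sieve
open Finset Filter
open scoped Classical

/-- Moebius, real-valued. -/
noncomputable def mu (n : ℕ) : ℝ := ((ArithmeticFunction.moebius n : ℤ) : ℝ)

theorem abs_mu_le (n : ℕ) : |mu n| ≤ 1 := by
  unfold mu
  exact_mod_cast ArithmeticFunction.abs_moebius_le_one

/-- all prime factors are at least `z`. -/
def rough (z n : ℕ) : Prop := ∀ p, p.Prime → p ∣ n → z ≤ p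

/-- Moebius sum over rough numbers. -/
noncomputable def Mr (z x : ℕ) : ℝ := ∑ n ∈ Icc 1 x, if rough z n then mu n else 0

/-- count of rough numbers. -/
noncomputable def Ph (z x : ℕ) : ℝ := ∑ n ∈ Icc 1 x, if rough z n then 1 else 0

theorem sum_multiples {M : Type*} [AddCommMonoid M] (f : ℕ → M) (z x : ℕ) (hz : 0 < z) :
    ∑ n ∈ Icc 1 x, (if z ∣ n then f n else 0) = ∑ m ∈ Icc 1 (x / z), f (z * m) := by
  rw [← sum_filter]
  symm
  apply sum_nbij (fun m => z * m)
  · intro m hm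
    simp only [mem_Icc, mem_filter] at hm ⊢
    refine ⟨⟨Nat.mul_pos hz hm.1, ?_⟩, dvd_mul_right _ _⟩
    calc z * m ≤ z * (x / z) := Nat.mul_le_mul_left _ hm.2
      _ ≤ x := Nat.mul_div_le _ _
  · intro a _ b _ h
    exact Nat.eq_of_mul_eq_mul_left hz h
  · intro n hn
    simp only [coe_filter, mem_Icc, Set.mem_ofPred_eq] at hn
    obtain ⟨⟨h1, h2⟩, m, rfl⟩ := hn
    refine ⟨m, ?_, rfl⟩
    simp only [coe_Icc, Set.mem_Icc]
    refine ⟨Nat.pos_of_mul_pos_left h1, ?_⟩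
    rw [Nat.le_div_iff_mul_le hz]; linarith
  · intros; rfl

theorem rough_succ_of_not_prime {z n : ℕ} (hz : ¬ z.Prime) : rough (z+1) n ↔ rough z n := by
  constructor
  · intro h p hp hd
    have := h p hp hd; omega
  · intro h p hp hd
    have := h p hp hd
    have : z ≠ p := fun h => hz (h ▸ hp)
    omega

theorem rough_succ_of_prime {z n : ℕ} (hz : z.Prime) : rough (z+1) n ↔ rough z n ∧ ¬ z ∣ n := by
  constructor
  · intro h
    refine ⟨fun p hp hd => ?_, fun hd => ?_⟩
    · have := h p hp hd; omega
    · have := h z hz hd; omega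
  · rintro ⟨h, h'⟩ p hp hd
    have := h p hp hd
    have : z ≠ p := fun h => h' (h ▸ hd)
    omega

theorem rough_mul {z m : ℕ} (hz : z.Prime) : rough z (z * m) ↔ rough z m := by
  constructor
  · intro h p hp hd
    exact h p hp (dvd_mul_of_dvd_right hd _)
  · intro h p hp hd
    rcases (Nat.Prime.dvd_mul hp).mp hd with h1 | h1
    · exact ((Nat.prime_dvd_prime_iff_eq hp hz).mp h1).ge
    · exact h p hp h1

theorem mu_mul_prime {z m : ℕ} (hz : z.Prime) : mu (z * m) = if z ∣ m then 0 else - mu m := by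
  unfold mu
  split_ifs with h
  · obtain ⟨k, rfl⟩ := h
    rw [ArithmeticFunction.moebius_eq_zero_of_not_squarefree]; · simp
    intro hs
    have := hs z ⟨k, by ring⟩
    exact hz.one_lt.ne' (Nat.isUnit_iff.mp this)
  · rw [ArithmeticFunction.isMultiplicative_moebius.map_mul_of_coprime ((Nat.Prime.coprime_iff_not_dvd hz).mpr h), ArithmeticFunction.moebius_apply_prime hz]
    push_cast; ring

theorem Mr_rec {z : ℕ} (hz : z.Prime) (x : ℕ) : Mr z x = Mr (z+1) x - Mr (z+1) (x / z) := by
  have h1 : Mr z x = Mr (z+1) x + ∑ n ∈ Icc 1 x, (if z ∣ n then (if rough z n then mu n else 0) else 0) := by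
    unfold Mr
    rw [← sum_add_distrib]
    apply sum_congr rfl
    intro n _
    simp only [rough_succ_of_prime hz]
    by_cases h1 : z ∣ n <;> by_cases h2 : rough z n <;> simp [h1, h2]
  rw [h1, sum_multiples (fun n => if rough z n then mu n else 0) z x hz.pos]
  have : ∑ m ∈ Icc 1 (x / z), (if rough z (z * m) then mu (z * m) else 0) = - Mr (z+1) (x / z) := by
    unfold Mr
    rw [← sum_neg_distrib]
    apply sum_congr rfl
    intro n _
    simp only [rough_succ_of_prime hz, rough_mul hz, mu_mul_prime hz]
    by_cases h1 : z ∣ n <;> by_cases h2 : rough z n <;> simp [h1, h2]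
  rw [this]; ring

theorem Ph_rec {z : ℕ} (hz : z.Prime) (x : ℕ) : Ph (z+1) x = Ph z x - Ph z (x / z) := by
  have h1 : Ph z x = Ph (z+1) x + ∑ n ∈ Icc 1 x, (if z ∣ n then (if rough z n then (1:ℝ) else 0) else 0) := by
    unfold Ph
    rw [← sum_add_distrib]
    apply sum_congr rfl
    intro n _
    simp only [rough_succ_of_prime hz]
    by_cases h1 : z ∣ n <;> by_cases h2 : rough z n <;> simp [h1, h2]
  rw [h1, sum_multiples (fun n => if rough z n then (1:ℝ) else 0) z x hz.pos]
  simp only [rough_mul hz]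
  unfold Ph; ring

theorem tendsto_natdiv (z : ℕ) (hz : 0 < z) :
    Tendsto (fun x : ℕ => ((x / z : ℕ) : ℝ) / x) atTop (nhds (1 / z)) := by
  have := (tendsto_nat_floor_mul_div_atTop (R := ℝ) (a := 1 / z) (by positivity)).comp tendsto_natCast_atTop_atTop (α := ℕ)
  refine this.congr fun x => ?_
  simp only [Function.comp]
  congr 2
  rw [← Nat.floor_div_eq_div (K := ℝ)]
  congr 1; ring

theorem tendsto_div_atTop' (z : ℕ) (hz : 0 < z) : Tendsto (fun x : ℕ => x / z) atTop atTop :=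
  Nat.tendsto_div_const_atTop hz.ne'

theorem tendsto_comp_div {f : ℕ → ℝ} {l : ℝ} (hf : Tendsto (fun x : ℕ => f x / x) atTop (nhds l)) (z : ℕ) (hz : 0 < z) :
    Tendsto (fun x : ℕ => f (x / z) / x) atTop (nhds (l * (1 / z))) := by
  have h := (hf.comp (tendsto_div_atTop' z hz)).mul (tendsto_natdiv z hz)
  refine h.congr' ?_
  filter_upwards [eventually_ge_atTop z] with x hx
  have : ((x / z : ℕ) : ℝ) ≠ 0 := by
    have := Nat.div_pos hx hz
    positivity
  simp only [Function.comp]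
  field_simp

theorem Mr_abs_le (z x : ℕ) : |Mr z x| ≤ x := by
  unfold Mr
  calc _ ≤ ∑ n ∈ Icc 1 x, |if rough z n then mu n else 0| := abs_sum_le_sum_abs _ _
    _ ≤ ∑ n ∈ Icc 1 x, (1:ℝ) := by
        apply sum_le_sum; intro n _
        split_ifs
        · exact abs_mu_le n
        · simp
    _ = x := by simp

theorem iter_lemma {f h : ℕ → ℝ} (z : ℕ) (hz : 2 ≤ z) (hf : Tendsto (fun x : ℕ => f x / x) atTop (nhds 0))
    (hh : ∀ x : ℕ, |h x| ≤ x) (hr : ∀ x, h x = f x + h (x / z)) : Tendsto (fun x : ℕ => h x / x) atTop (nhds 0) := by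
  have key : ∀ J : ℕ, ∀ ε > 0, ∀ᶠ x : ℕ in atTop, |h x| ≤ ((1/2)^J + ε) * x := by
    intro J
    induction J with
    | zero =>
      intro ε hε
      filter_upwards with x
      have := hh x
      have h0 : (0:ℝ) ≤ x := by positivity
      nlinarith
    | succ J ih =>
      intro ε hε
      have h1 := (tendsto_div_atTop' z (by omega)).eventually (ih ε hε)
      have h2 := hf.abs.eventually (ge_mem_nhds (show |(0:ℝ)| < ε/2 by simpa using by positivity))
      filter_upwards [h1, h2, eventually_gt_atTop 0] with x h1 h2 h3
      have h3' : (0:ℝ) < x := by exact_mod_cast h3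
      rw [abs_div, abs_of_pos h3', div_le_iff₀ h3'] at h2
      rw [hr x]
      have h4 : ((x / z : ℕ) : ℝ) ≤ x / 2 := by
        have : x / z ≤ x / 2 := Nat.div_le_div_left hz (by norm_num)
        calc ((x / z : ℕ) : ℝ) ≤ ((x / 2 : ℕ) : ℝ) := by exact_mod_cast this
          _ ≤ x / 2 := by exact_mod_cast Nat.cast_div_le
      have h5 : |h (x / z)| ≤ ((1/2)^J + ε) * (x / 2) := h1.trans (by gcongr)
      have := abs_add_le (f x) (h (x/z))
      rw [pow_succ]
      nlinarith
  rw [Metric.tendsto_atTop']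
  intro ε hε
  obtain ⟨J, hJ⟩ := exists_pow_lt_of_lt_one (show 0 < ε/2 by positivity) (show (1/2:ℝ) < 1 by norm_num)
  obtain ⟨N, hN⟩ := eventually_atTop.mp ((key J (ε/2) (by positivity)).and (eventually_gt_atTop 0))
  refine ⟨N, fun x hx => ?_⟩
  obtain ⟨h1, h2⟩ := hN x hx.le
  have h2' : (0:ℝ) < x := by exact_mod_cast h2
  rw [Real.dist_0_eq_abs, abs_div, abs_of_pos h2', div_lt_iff₀ h2']
  nlinarith

theorem Mr_tendsto (z : ℕ) : Tendsto (fun x : ℕ => Mr z x / x) atTop (nhds 0) := by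
  induction z with
  | zero =>
    have := (Complex.continuous_re.tendsto 0).comp Mf_tendsto
    simp only [Complex.zero_re] at this
    refine this.congr fun x => ?_
    simp only [Function.comp]
    rw [Complex.div_natCast_re]
    congr 1
    simp [Mf, Mr, rough, mu]
  | succ z ih =>
    by_cases hz : z.Prime
    · refine iter_lemma z hz.two_le ih (Mr_abs_le _) fun x => ?_
      rw [Mr_rec hz]; ring
    · refine ih.congr fun x => ?_
      simp only [Mr, rough_succ_of_not_prime hz]

theorem Ph_tendsto (z : ℕ) : Tendsto (fun x : ℕ => Ph z x / x) atTop (nhds (∏ p ∈ (range z).filter Nat.Prime, (1 - 1 / (p:ℝ)))) := by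
  induction z with
  | zero =>
    simp only [range_zero, filter_empty, prod_empty]
    refine tendsto_const_nhds.congr' ?_
    filter_upwards [eventually_gt_atTop 0] with x hx
    have : (x:ℝ) ≠ 0 := by positivity
    simp [Ph, rough, this]
  | succ z ih =>
    rw [range_add_one, filter_insert]
    by_cases hz : z.Prime
    · rw [if_pos hz, prod_insert (by simp)]
      have := ih.sub (tendsto_comp_div ih z hz.pos)
      have e : ∀ t : ℝ, (1 - 1 / (z:ℝ)) * t = t - t * (1 / z) := fun t => by ring
      rw [e]
      refine this.congr fun x => ?_
      rw [Ph_rec hz]; ring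
    · rw [if_neg hz]
      refine ih.congr fun x => ?_
      simp only [Ph, rough_succ_of_not_prime hz]

theorem prod_tendsto : Tendsto (fun z : ℕ => ∏ p ∈ (range z).filter Nat.Prime, (1 - 1 / (p:ℝ))) atTop (nhds 0) := by
  have h1 : Tendsto (fun z : ℕ => ∑ p ∈ (range z).filter Nat.Prime, (1 / (p:ℝ))) atTop atTop := by
    have := not_summable_one_div_on_primes
    have h2 := (not_summable_iff_tendsto_nat_atTop_of_nonneg (f := Set.indicator {p : ℕ | p.Prime} (fun n : ℕ => (1:ℝ) / n)) (by
      intro n; apply Set.indicator_nonneg; intros; positivity)).mp this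
    refine h2.congr fun z => ?_
    rw [sum_filter]
    apply sum_congr rfl
    intro p _
    simp [Set.indicator_apply]
  have h2 := Real.tendsto_exp_neg_atTop_nhds_zero.comp h1
  refine squeeze_zero ?_ ?_ h2
  · intro z
    apply prod_nonneg
    intro p hp
    have : (1:ℝ) ≤ p := by exact_mod_cast (mem_filter.mp hp).2.one_le
    rw [sub_nonneg, div_le_one (by linarith)]; exact this
  · intro z
    simp only [Function.comp]
    rw [← sum_neg_distrib, Real.exp_sum]
    apply Finset.prod_le_prod
    · intro p hp
      have : (1:ℝ) ≤ p := by exact_mod_cast (mem_filter.mp hp).2.one_le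
      rw [sub_nonneg, div_le_one (by linarith)]; exact this
    · intro p hp
      have := Real.add_one_le_exp (-(1 / (p:ℝ)))
      linarith

/-- Moebius restricted to smallest prime factor in `S`. -/
noncomputable def cS (S : Set ℕ) (n : ℕ) : ℝ := if n.minFac ∈ S then mu n else 0

theorem abs_cS_le (S : Set ℕ) (n : ℕ) : |cS S n| ≤ 1 := by
  unfold cS
  split_ifs
  · exact abs_mu_le n
  · simp

theorem minFac_eq_iff {p n : ℕ} (hp : p.Prime) : n.minFac = p ↔ rough p n ∧ ¬ rough (p+1) n := by
  rw [rough_succ_of_prime hp]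
  constructor
  · rintro rfl
    have h1 : rough n.minFac n := fun q hq hd => Nat.minFac_le_of_dvd hq.two_le hd
    exact ⟨h1, fun h => h.2 (Nat.minFac_dvd n)⟩
  · rintro ⟨h1, h2⟩
    have h3 : p ∣ n := by by_contra h; exact h2 ⟨h1, h⟩
    apply le_antisymm (Nat.minFac_le_of_dvd hp.two_le h3)
    apply h1 _ _ (Nat.minFac_dvd n)
    apply Nat.minFac_prime
    rintro rfl
    exact hp.one_lt.ne' (Nat.dvd_one.mp h3)

theorem cSz_tendsto (S : Set ℕ) (hS : ∀ p ∈ S, Nat.Prime p) (z : ℕ) :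
    Tendsto (fun x : ℕ => (∑ n ∈ Icc 1 x, if n.minFac < z then cS S n else 0) / x) atTop (nhds 0) := by
  induction z with
  | zero => simp
  | succ z ih =>
    by_cases hz : z ∈ S
    · have h := ih.add ((Mr_tendsto z).sub (Mr_tendsto (z+1)))
      simp only [sub_zero, add_zero] at h
      refine h.congr fun x => ?_
      rw [← sub_div, ← add_div]
      congr 1
      unfold Mr
      rw [← sum_sub_distrib, ← sum_add_distrib]
      apply sum_congr rfl
      intro n _
      have h1 := minFac_eq_iff (n := n) (hS z hz)
      by_cases h2 : n.minFac = z
      · obtain ⟨h3, h4⟩ := h1.mp h2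
        simp [h2, h3, h4, cS, hz]
      · have h5 : n.minFac < z + 1 ↔ n.minFac < z := by omega
        have h6 : rough z n ↔ rough (z+1) n := by
          constructor
          · intro h; by_contra h'; exact h2 (h1.mpr ⟨h, h'⟩)
          · intro h; exact ((rough_succ_of_prime (hS z hz)).mp h).1
        simp [h5, h6]
    · refine ih.congr fun x => ?_
      congr 1
      apply sum_congr rfl
      intro n _
      by_cases h2 : n.minFac = z
      · simp [h2, cS, hz]
      · have h5 : n.minFac < z + 1 ↔ n.minFac < z := by omega
        simp [h5]

theorem cS_tendsto (S : Set ℕ) (hS : ∀ p ∈ S, Nat.Prime p) :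
    Tendsto (fun x : ℕ => (∑ n ∈ Icc 1 x, cS S n) / x) atTop (nhds 0) := by
  rw [Metric.tendsto_atTop']
  intro ε hε
  obtain ⟨z, hz⟩ := (prod_tendsto.eventually (gt_mem_nhds (show 0 < ε/2 by positivity))).exists
  have h1 := (Ph_tendsto z).eventually (gt_mem_nhds hz)
  have h2 := (cSz_tendsto S hS z).abs.eventually (gt_mem_nhds (show |(0:ℝ)| < ε/2 by simpa using by positivity))
  obtain ⟨N, hN⟩ := eventually_atTop.mp ((h1.and h2).and (eventually_gt_atTop 0))
  refine ⟨N, fun x hx => ?_⟩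
  obtain ⟨⟨h1, h2⟩, h3⟩ := hN x hx.le
  have h3' : (0:ℝ) < x := by exact_mod_cast h3
  rw [Real.dist_0_eq_abs, abs_div, abs_of_pos h3', div_lt_iff₀ h3']
  rw [abs_div, abs_of_pos h3', div_lt_iff₀ h3'] at h2
  rw [div_lt_iff₀ h3'] at h1
  have h4 : |∑ n ∈ Icc 1 x, cS S n - ∑ n ∈ Icc 1 x, (if n.minFac < z then cS S n else 0)| ≤ Ph z x := by
    rw [← sum_sub_distrib]
    refine (abs_sum_le_sum_abs _ _).trans ?_
    unfold Ph
    apply sum_le_sum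
    intro n _
    by_cases h5 : n.minFac < z
    · simp [h5]; split_ifs <;> simp
    · have : rough z n := fun p hp hd => (not_lt.mp h5).trans (Nat.minFac_le_of_dvd hp.two_le hd)
      simp [h5, this, abs_cS_le]
  have := abs_sub_abs_le_abs_sub (∑ n ∈ Icc 1 x, cS S n) (∑ n ∈ Icc 1 x, (if n.minFac < z then cS S n else 0))
  linarith
end sieve

section axer
open Finset Filter
open scoped Classical

theorem abel_id (c : ℕ → ℝ) (N x : ℕ) (h : N ≤ x) :
    ∑ n ∈ Ioc N x, c n / n = (∑ n ∈ Icc 1 x, c n) / (x + 1) - (∑ n ∈ Icc 1 N, c n) / (N + 1) +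
      ∑ n ∈ Ioc N x, (∑ k ∈ Icc 1 n, c k) * (1 / (n:ℝ) - 1 / (n + 1)) := by
  induction x, h using Nat.le_induction with
  | base => simp
  | succ x hx ih =>
    rw [sum_Ioc_succ_top (by omega), sum_Ioc_succ_top (by omega), ih, sum_Icc_succ_top (by omega)]
    push_cast
    have h1 : (x:ℝ) + 1 ≠ 0 := by positivity
    have h2 : (x:ℝ) + 1 + 1 ≠ 0 := by positivity
    field_simp
    ring

theorem log_part (c : ℕ → ℝ) (hC : Tendsto (fun x : ℕ => (∑ n ∈ Icc 1 x, c n) / x) atTop (nhds 0))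
    (K : ℕ) (hK : 0 < K) : Tendsto (fun x : ℕ => ∑ n ∈ Ioc (x / K) x, c n / n) atTop (nhds 0) := by
  rw [Metric.tendsto_atTop']
  intro ε hε
  set η := ε / (2 * (3 + 2 * K)) with hη
  have hη0 : 0 < η := by positivity
  have h1 := hC.abs.eventually (ge_mem_nhds (show |(0:ℝ)| < η by simpa using hη0))
  obtain ⟨N₀, hN₀⟩ := eventually_atTop.mp h1
  have hb : ∀ n : ℕ, N₀ ≤ n → |∑ k ∈ Icc 1 n, c k| ≤ η * n := by
    intro n hn
    rcases Nat.eq_zero_or_pos n with rfl | h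
    · simp
    · have h' : (0:ℝ) < n := by exact_mod_cast h
      have := hN₀ n hn
      rwa [abs_div, abs_of_pos h', div_le_iff₀ h'] at this
  obtain ⟨N₁, hN₁⟩ := eventually_atTop.mp ((tendsto_div_atTop' K hK).eventually (eventually_ge_atTop (max N₀ 1)))
  refine ⟨N₁, fun x hx => ?_⟩
  have h2 := hN₁ x hx.le
  set N := x / K with hN
  have hNx : N ≤ x := Nat.div_le_self _ _
  have hN0 : N₀ ≤ N := (le_max_left _ _).trans h2
  have hN1 : 1 ≤ N := (le_max_right _ _).trans h2
  have hxN : x ≤ 2 * K * N := by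
    have := Nat.lt_mul_div_succ x hK
    rw [← hN] at this
    nlinarith
  have hxN' : (x:ℝ) ≤ 2 * K * N := by exact_mod_cast hxN
  rw [Real.dist_0_eq_abs, abel_id c N x hNx]
  have b1 : |(∑ n ∈ Icc 1 x, c n) / (x + 1)| ≤ η := by
    rw [abs_div, abs_of_pos (by positivity : (0:ℝ) < x + 1), div_le_iff₀ (by positivity)]
    have := hb x (hN0.trans hNx)
    linarith
  have b2 : |(∑ n ∈ Icc 1 N, c n) / (N + 1)| ≤ η := by
    rw [abs_div, abs_of_pos (by positivity : (0:ℝ) < N + 1), div_le_iff₀ (by positivity)]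
    have := hb N hN0
    linarith
  have b3 : |∑ n ∈ Ioc N x, (∑ k ∈ Icc 1 n, c k) * (1 / (n:ℝ) - 1 / (n + 1))| ≤ η * (2 * K) := by
    have hNpos : (0:ℝ) < N := by exact_mod_cast hN1
    calc _ ≤ ∑ n ∈ Ioc N x, |(∑ k ∈ Icc 1 n, c k) * (1 / (n:ℝ) - 1 / (n + 1))| := abs_sum_le_sum_abs _ _
      _ ≤ ∑ n ∈ Ioc N x, η * (1 / N) := by
          apply sum_le_sum
          intro n hn
          have hn' := (mem_Ioc.mp hn).1
          have hnp : (0:ℝ) < n := by exact_mod_cast (by omega : 0 < n)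
          have hnN : (N:ℝ) ≤ n + 1 := by exact_mod_cast (by omega : N ≤ n + 1)
          have e : 1 / (n:ℝ) - 1 / (n + 1) = 1 / (n * (n + 1)) := by field_simp; ring
          rw [e, abs_mul, abs_of_pos (by positivity : 0 < 1 / ((n:ℝ) * (n+1)))]
          calc _ ≤ (η * n) * (1 / ((n:ℝ) * (n+1))) := by
                gcongr
                exact hb n (by omega)
            _ = η * (1 / (n + 1)) := by field_simp
            _ ≤ _ := by gcongr
      _ = η * ((x - N : ℕ) / N) := by
          rw [sum_const, Nat.card_Ioc, nsmul_eq_mul]; ring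
      _ ≤ _ := by
          gcongr
          rw [div_le_iff₀ hNpos]
          refine le_trans ?_ hxN'
          exact_mod_cast Nat.sub_le _ _
  have t1 := abs_add_le ((∑ n ∈ Icc 1 x, c n) / ((x:ℝ) + 1) - (∑ n ∈ Icc 1 N, c n) / ((N:ℝ) + 1)) (∑ n ∈ Ioc N x, (∑ k ∈ Icc 1 n, c k) * (1 / (n:ℝ) - 1 / (n + 1)))
  have t2 := abs_sub ((∑ n ∈ Icc 1 x, c n) / ((x:ℝ) + 1)) ((∑ n ∈ Icc 1 N, c n) / ((N:ℝ) + 1))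
  have hη1 : η * (3 + 2 * K) = ε / 2 := by rw [hη]; field_simp
  nlinarith

theorem floor_part (c : ℕ → ℝ) (hC : Tendsto (fun x : ℕ => (∑ n ∈ Icc 1 x, c n) / x) atTop (nhds 0))
    (K : ℕ) (hK : 0 < K) : Tendsto (fun x : ℕ => (∑ n ∈ Ioc (x / K) x, c n * ((x / n : ℕ) : ℝ)) / x) atTop (nhds 0) := by
  have h1 : Tendsto (fun x : ℕ => ∑ k ∈ Icc 1 K, ((∑ n ∈ Icc 1 (x / k), c n) / x - (∑ n ∈ Icc 1 (x / K), c n) / x)) atTop (nhds (∑ k ∈ Icc 1 K, (0 * (1 / (k:ℝ)) - 0 * (1 / (K:ℝ))))) := by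
    apply tendsto_finsetSum
    intro k hk
    exact (tendsto_comp_div (f := fun x => ∑ n ∈ Icc 1 x, c n) hC k (mem_Icc.mp hk).1).sub
      (tendsto_comp_div (f := fun x => ∑ n ∈ Icc 1 x, c n) hC K hK)
  simp only [zero_mul, sub_zero, sum_const_zero] at h1
  refine h1.congr fun x => ?_
  simp_rw [← sub_div]
  rw [← sum_div]
  congr 1
  have h2 : ∀ n ∈ Ioc (x / K) x, c n * ((x / n : ℕ) : ℝ) = ∑ k ∈ Icc 1 K, if n ≤ x / k then c n else 0 := by
    intro n hn
    obtain ⟨hn1, hn2⟩ := mem_Ioc.mp hn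
    have hn0 : 0 < n := (Nat.zero_le _).trans_lt hn1
    have hle : x / n ≤ K := by
      have := (Nat.div_lt_iff_lt_mul hK).mp hn1
      apply Nat.le_of_lt_succ
      rw [Nat.div_lt_iff_lt_mul hn0]
      nlinarith
    rw [← sum_filter]
    have : (Icc 1 K).filter (fun k => n ≤ x / k) = Icc 1 (x / n) := by
      ext k
      simp only [mem_filter, mem_Icc]
      constructor
      · rintro ⟨⟨h1, h2⟩, h3⟩
        refine ⟨h1, ?_⟩
        rw [Nat.le_div_iff_mul_le h1] at h3
        rw [Nat.le_div_iff_mul_le hn0]; linarith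
      · rintro ⟨h1, h2⟩
        refine ⟨⟨h1, h2.trans hle⟩, ?_⟩
        rw [Nat.le_div_iff_mul_le hn0] at h2
        rw [Nat.le_div_iff_mul_le h1]; linarith
    rw [this]; simp [mul_comm]
  rw [sum_congr rfl h2, sum_comm]
  apply sum_congr rfl
  intro k hk
  obtain ⟨hk1, hk2⟩ := mem_Icc.mp hk
  have h3 : x / K ≤ x / k := Nat.div_le_div_left hk2 hk1
  have h4 : x / k ≤ x := Nat.div_le_self _ _
  rw [← sum_filter]
  have : (Ioc (x / K) x).filter (fun n => n ≤ x / k) = Icc 1 (x/k) \ Icc 1 (x/K) := by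
    generalize x / K = A at *
    generalize x / k = B at *
    ext n; simp; omega
  rw [this, sum_sdiff_eq_sub (Icc_subset_Icc_right h3)]

theorem axer (c : ℕ → ℝ) (hc : ∀ n, |c n| ≤ 1) (hC : Tendsto (fun x : ℕ => (∑ n ∈ Icc 1 x, c n) / x) atTop (nhds 0)) :
    Tendsto (fun x : ℕ => (∑ n ∈ Icc 1 x, c n * ((x:ℝ) / n - ((x / n : ℕ) : ℝ))) / x) atTop (nhds 0) := by
  rw [Metric.tendsto_atTop']
  intro ε hε
  obtain ⟨K', hK'⟩ := exists_nat_one_div_lt (show 0 < ε/2 by positivity)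
  set K := K' + 1 with hKd
  have hK : 0 < K := by omega
  have hKε : 1 / (K:ℝ) < ε / 2 := by rw [hKd]; push_cast; exact hK'
  have hT := (log_part c hC K hK).sub (floor_part c hC K hK)
  rw [sub_zero] at hT
  obtain ⟨N, hN⟩ := eventually_atTop.mp ((hT.abs.eventually (gt_mem_nhds (show |(0:ℝ)| < ε/2 by simpa using by positivity))).and (eventually_gt_atTop 0))
  refine ⟨N, fun x hx => ?_⟩
  obtain ⟨h1, h2⟩ := hN x hx.le
  have hx0 : (0:ℝ) < x := by exact_mod_cast h2
  have e : Icc 1 x = Icc 1 (x/K) ∪ Ioc (x/K) x := by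
    have h3 := Nat.div_le_self x K
    generalize x / K = A at h3
    ext n; simp; omega
  have hd : Disjoint (Icc 1 (x/K)) (Ioc (x/K) x) := by
    rw [disjoint_left]; intro n; simp; omega
  rw [e, sum_union hd, add_div]
  have e2 : (∑ n ∈ Ioc (x/K) x, c n * ((x:ℝ) / n - ((x / n : ℕ) : ℝ))) / x = ∑ n ∈ Ioc (x / K) x, c n / n - (∑ n ∈ Ioc (x / K) x, c n * ((x / n : ℕ) : ℝ)) / x := by
    simp_rw [mul_sub]
    rw [sum_sub_distrib, sub_div]
    congr 1
    rw [sum_div]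
    apply sum_congr rfl
    intro n _
    field_simp
  rw [e2]
  have b : |(∑ n ∈ Icc 1 (x/K), c n * ((x:ℝ) / n - ((x / n : ℕ) : ℝ))) / x| ≤ 1 / K := by
    rw [abs_div, abs_of_pos hx0, div_le_iff₀ hx0]
    calc _ ≤ ∑ n ∈ Icc 1 (x/K), |c n * ((x:ℝ) / n - ((x / n : ℕ) : ℝ))| := abs_sum_le_sum_abs _ _
      _ ≤ ∑ n ∈ Icc 1 (x/K), (1:ℝ) := by
          apply sum_le_sum
          intro n hn
          have h3 : ((x / n : ℕ) : ℝ) ≤ x / n := Nat.cast_div_le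
          have h4 : (x:ℝ) / n < ((x / n : ℕ) : ℝ) + 1 := by
            rw [← Nat.floor_div_eq_div (K := ℝ)]; exact Nat.lt_floor_add_one _
          rw [abs_mul, abs_of_nonneg (sub_nonneg.mpr h3)]
          exact mul_le_one₀ (hc n) (by linarith) (by linarith)
      _ = ((x / K : ℕ) : ℝ) := by simp
      _ ≤ x / K := Nat.cast_div_le
      _ = _ := by ring
  rw [Real.dist_0_eq_abs]
  have := abs_add_le ((∑ n ∈ Icc 1 (x/K), c n * ((x:ℝ) / n - ((x / n : ℕ) : ℝ))) / x) (∑ n ∈ Ioc (x / K) x, c n / n - (∑ n ∈ Ioc (x / K) x, c n * ((x / n : ℕ) : ℝ)) / x)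
  linarith

/-- largest prime factor. -/
def gpf (n : ℕ) : ℕ := n.primeFactors.sup id

theorem gpf_one : gpf 1 = 0 := by simp [gpf]

theorem le_gpf {p n : ℕ} (hn : n ≠ 0) (hp : p.Prime) (h : p ∣ n) : p ≤ gpf n :=
  Finset.le_sup (f := id) (Nat.mem_primeFactors.mpr ⟨hp, h, hn⟩)

theorem gpf_mem {n : ℕ} (hn : 2 ≤ n) : gpf n ∈ n.primeFactors := by
  have hne : n.primeFactors.Nonempty := Nat.nonempty_primeFactors.mpr hn
  obtain ⟨p, hp, h⟩ := exists_mem_eq_sup _ hne (id : ℕ → ℕ)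
  unfold gpf
  rw [h]; exact hp

theorem gpf_prime {n : ℕ} (hn : 2 ≤ n) : (gpf n).Prime := Nat.prime_of_mem_primeFactors (gpf_mem hn)
theorem gpf_dvd {n : ℕ} (hn : 2 ≤ n) : gpf n ∣ n := Nat.dvd_of_mem_primeFactors (gpf_mem hn)

theorem duality (S : Set ℕ) (hS : ∀ p ∈ S, Nat.Prime p) (m : ℕ) (hm : 1 ≤ m) :
    ∑ d ∈ m.divisors, cS S d = - (if gpf m ∈ S then 1 else 0) := by
  have h1S : 1 ∉ S := fun h => Nat.not_prime_one (hS 1 h)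
  have h0S : 0 ∉ S := fun h => Nat.not_prime_zero (hS 0 h)
  rcases Nat.lt_or_ge m 2 with h | hm2
  · obtain rfl : m = 1 := by omega
    simp [gpf_one, cS, h1S, h0S]
  set P := gpf m with hP
  have hPp : P.Prime := gpf_prime hm2
  have hPd : P ∣ m := gpf_dvd hm2
  rw [← sum_filter_add_sum_filter_not m.divisors (fun d => P ∣ d)]
  have h2 : ∑ d ∈ m.divisors.filter (fun d => P ∣ d), cS S d = ∑ e ∈ m.divisors.filter (fun d => ¬ P ∣ d), cS S (P * e) := by
    rw [← sum_image (f := cS S) (g := fun e => P * e) (fun a _ b _ h => Nat.eq_of_mul_eq_mul_left hPp.pos h)]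
    symm
    apply sum_subset
    · intro d hd
      obtain ⟨e, he, rfl⟩ := mem_image.mp hd
      simp only [mem_filter, Nat.mem_divisors] at he ⊢
      refine ⟨⟨?_, he.1.2⟩, dvd_mul_right _ _⟩
      exact Nat.Coprime.mul_dvd_of_dvd_of_dvd ((Nat.Prime.coprime_iff_not_dvd hPp).mpr he.2) hPd he.1.1
    · intro d hd hd'
      simp only [mem_filter, Nat.mem_divisors] at hd
      obtain ⟨⟨h3, h4⟩, e, rfl⟩ := hd
      have : P ∣ e := by
        by_contra hne
        apply hd'
        refine mem_image.mpr ⟨e, ?_, rfl⟩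
        simp only [mem_filter, Nat.mem_divisors]
        exact ⟨⟨(dvd_mul_left _ _).trans h3, h4⟩, hne⟩
      simp [cS, mu_mul_prime hPp, this]
  rw [h2, ← sum_add_distrib]
  rw [sum_eq_single 1]
  · have : ¬ P ∣ 1 := fun h => hPp.one_lt.ne' (Nat.dvd_one.mp h)
    simp [cS, h1S, hPp.minFac_eq]
    split_ifs with h
    · simp [mu, ArithmeticFunction.moebius_apply_prime hPp]
    · simp
  · intro e he he1
    simp only [mem_filter, Nat.mem_divisors] at he
    have he0 : e ≠ 0 := fun h => he.2 (h ▸ dvd_zero _)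
    have hmin : (P * e).minFac = e.minFac := by
      have hep : e.minFac.Prime := Nat.minFac_prime he1
      apply le_antisymm
      · exact Nat.minFac_le_of_dvd hep.two_le ((Nat.minFac_dvd e).trans (dvd_mul_left _ _))
      · have hq : (P * e).minFac.Prime := Nat.minFac_prime (by
          intro h; exact hPp.one_lt.ne' (Nat.eq_one_of_mul_eq_one_right h))
        rcases (Nat.Prime.dvd_mul hq).mp (Nat.minFac_dvd (P * e)) with h | h
        · rw [(Nat.prime_dvd_prime_iff_eq hq hPp).mp h]
          exact le_gpf (by omega) hep ((Nat.minFac_dvd e).trans he.1.1)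
        · exact Nat.minFac_le_of_dvd hq.two_le h
    simp only [cS, hmin, mu_mul_prime hPp, if_neg he.2]
    split_ifs <;> ring
  · intro h
    exfalso; apply h
    simp only [mem_filter, Nat.mem_divisors]
    exact ⟨⟨one_dvd _, by omega⟩, fun h => hPp.one_lt.ne' (Nat.dvd_one.mp h)⟩

/-- count with largest prime factor in S. -/
noncomputable def W (S : Set ℕ) (x : ℕ) : ℝ := ∑ m ∈ Icc 1 x, if gpf m ∈ S then 1 else 0

theorem sum_floor (S : Set ℕ) (hS : ∀ p ∈ S, Nat.Prime p) (x : ℕ) :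
    ∑ n ∈ Icc 1 x, cS S n * ((x / n : ℕ) : ℝ) = - W S x := by
  have h1 : ∀ n ∈ Icc 1 x, cS S n * ((x / n : ℕ) : ℝ) = ∑ m ∈ Icc 1 x, if n ∣ m then cS S n else 0 := by
    intro n hn
    rw [sum_multiples (fun _ => cS S n) n x (mem_Icc.mp hn).1]
    simp [mul_comm]
  rw [sum_congr rfl h1, sum_comm, W, ← sum_neg_distrib]
  apply sum_congr rfl
  intro m hm
  obtain ⟨hm1, hm2⟩ := mem_Icc.mp hm
  rw [← duality S hS m hm1, ← sum_filter]
  apply sum_congr _ (fun _ _ => rfl)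
  ext d
  simp only [mem_filter, mem_Icc, Nat.mem_divisors]
  constructor
  · rintro ⟨_, h⟩; exact ⟨h, by omega⟩
  · rintro ⟨h, _⟩
    exact ⟨⟨Nat.pos_of_dvd_of_pos h hm1, (Nat.le_of_dvd hm1 h).trans hm2⟩, h⟩

theorem sum_eq (S : Set ℕ) (hS : ∀ p ∈ S, Nat.Prime p) (x : ℕ) (hx : 0 < x) :
    ∑ n ∈ Icc 1 x, cS S n / n = - (W S x / x) + (∑ n ∈ Icc 1 x, cS S n * ((x:ℝ) / n - ((x / n : ℕ) : ℝ))) / x := by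
  have hx0 : (x:ℝ) ≠ 0 := by positivity
  simp_rw [mul_sub]
  rw [sum_sub_distrib, sum_floor S hS]
  have : ∑ n ∈ Icc 1 x, cS S n * ((x:ℝ) / n) = x * ∑ n ∈ Icc 1 x, cS S n / n := by
    rw [mul_sum]; apply sum_congr rfl; intros; ring
  rw [this]
  field_simp
  ring

theorem sum_bound (S : Set ℕ) (hS : ∀ p ∈ S, Nat.Prime p) (x : ℕ) :
    |∑ n ∈ Icc 1 x, cS S n / n| ≤ 2 := by
  rcases Nat.eq_zero_or_pos x with rfl | hx
  · simp
  have hx0 : (0:ℝ) < x := by positivity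
  rw [sum_eq S hS x hx]
  have b1 : |-(W S x / x)| ≤ 1 := by
    rw [abs_neg, abs_div, abs_of_pos hx0, div_le_one hx0]
    have h0 : 0 ≤ W S x := sum_nonneg fun _ _ => by split_ifs <;> simp
    rw [abs_of_nonneg h0]
    calc W S x ≤ ∑ m ∈ Icc 1 x, (1:ℝ) := sum_le_sum fun _ _ => by split_ifs <;> simp
      _ = x := by simp
  have b2 : |(∑ n ∈ Icc 1 x, cS S n * ((x:ℝ) / n - ((x / n : ℕ) : ℝ))) / x| ≤ 1 := by
    rw [abs_div, abs_of_pos hx0, div_le_one hx0]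
    calc _ ≤ ∑ n ∈ Icc 1 x, |cS S n * ((x:ℝ) / n - ((x / n : ℕ) : ℝ))| := abs_sum_le_sum_abs _ _
      _ ≤ ∑ n ∈ Icc 1 x, (1:ℝ) := by
          apply sum_le_sum
          intro n hn
          have h3 : ((x / n : ℕ) : ℝ) ≤ x / n := Nat.cast_div_le
          have h4 : (x:ℝ) / n < ((x / n : ℕ) : ℝ) + 1 := by
            rw [← Nat.floor_div_eq_div (K := ℝ)]; exact Nat.lt_floor_add_one _
          rw [abs_mul, abs_of_nonneg (sub_nonneg.mpr h3)]
          exact mul_le_one₀ (abs_cS_le S n) (by linarith) (by linarith)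
      _ = x := by simp
  have := abs_add_le (-(W S x / x)) ((∑ n ∈ Icc 1 x, cS S n * ((x:ℝ) / n - ((x / n : ℕ) : ℝ))) / x)
  linarith

theorem alladi_of_W (S : Set ℕ) (hS : ∀ p ∈ S, Nat.Prime p) (δ : ℝ)
    (hW : Tendsto (fun x : ℕ => W S x / x) atTop (nhds δ)) :
    Tendsto (fun x : ℕ => ∑ n ∈ Icc 1 x, cS S n / n) atTop (nhds (-δ)) := by
  have := hW.neg.add (axer (cS S) (abs_cS_le S) (cS_tendsto S hS))
  rw [add_zero] at this
  refine this.congr' ?_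
  filter_upwards [eventually_gt_atTop 0] with x hx
  rw [sum_eq S hS x hx]
end axer

section smooth
open Finset Filter
open scoped Classical

theorem log_eq_sum (n y : ℕ) (h : n.primeFactors ⊆ y.primesLE) :
    Real.log n = ∑ p ∈ y.primesLE, (n.factorization p : ℝ) * Real.log p := by
  rw [Real.log_nat_eq_sum_factorization, Finsupp.sum_of_support_subset _ h _ (by simp)]

theorem mertens_le (y : ℕ) (hy : 1 ≤ y) : ∑ p ∈ y.primesLE, Real.log p / p ≤ 2 * Real.log y := by
  have hy0 : (0:ℝ) < y := by exact_mod_cast hy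
  have h1 : Real.log (y.factorial : ℕ) = ∑ p ∈ y.primesLE, (y.factorial.factorization p : ℝ) * Real.log p := by
    apply log_eq_sum
    intro p hp
    have := Nat.prime_of_mem_primeFactors hp
    exact Nat.mem_primesLE.mpr ⟨(Nat.Prime.dvd_factorial this).mp (Nat.dvd_of_mem_primeFactors hp), this⟩
  have h2 : Real.log (y.factorial : ℕ) ≤ y * Real.log y := by
    rw [← Real.log_pow]
    apply Real.log_le_log (by exact_mod_cast Nat.factorial_pos y)
    exact_mod_cast Nat.factorial_le_pow y
  have h3 : (y:ℝ) / 2 * ∑ p ∈ y.primesLE, Real.log p / p ≤ Real.log (y.factorial : ℕ) := by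
    rw [h1, mul_sum]
    apply sum_le_sum
    intro p hp
    obtain ⟨hpy, hpp⟩ := Nat.mem_primesLE.mp hp
    have hp0 : (0:ℝ) < p := by exact_mod_cast hpp.pos
    have hf : y / p ≤ y.factorial.factorization p := by
      rw [Nat.factorization_factorial hpp (Nat.lt_succ_self _)]
      have : 1 ∈ Ico 1 (Nat.log p y).succ := by
        simp [Nat.log_pos hpp.one_lt hpy]
      have := single_le_sum (f := fun i => y / p ^ i) (fun _ _ => Nat.zero_le _) this
      simpa using this
    have hq : 1 ≤ y / p := Nat.div_pos hpy hpp.pos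
    have h5 : (y:ℝ) / p ≤ 2 * ((y / p : ℕ) : ℝ) := by
      have h4 : (y:ℝ) / p < ((y / p : ℕ) : ℝ) + 1 := by
        rw [← Nat.floor_div_eq_div (K := ℝ)]; exact Nat.lt_floor_add_one _
      have : (1:ℝ) ≤ ((y / p : ℕ) : ℝ) := by exact_mod_cast hq
      linarith
    have h6 : ((y / p : ℕ) : ℝ) ≤ (y.factorial.factorization p : ℝ) := by exact_mod_cast hf
    have hl : 0 ≤ Real.log p := Real.log_natCast_nonneg p
    calc (y:ℝ) / 2 * (Real.log p / p) = ((y:ℝ) / p / 2) * Real.log p := by ring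
      _ ≤ _ := by gcongr; linarith
  have h4 : (y:ℝ) / 2 * ∑ p ∈ y.primesLE, Real.log p / p ≤ (y:ℝ) / 2 * (2 * Real.log y) := by linarith
  exact le_of_mul_le_mul_left h4 (by positivity)

theorem sum_factorization (p x : ℕ) : ∑ n ∈ Icc 1 x, n.factorization p = x.factorial.factorization p := by
  induction x with
  | zero => simp
  | succ x ih =>
    rw [sum_Icc_succ_top (by omega), ih, Nat.factorial_succ, Nat.factorization_mul (by omega) (Nat.factorial_ne_zero _)]
    simp [add_comm]

theorem smooth_log (x y : ℕ) (hy : 1 ≤ y) :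
    ∑ n ∈ Icc 1 x, (if gpf n ≤ y then Real.log n else 0) ≤ 4 * x * Real.log y := by
  calc _ ≤ ∑ n ∈ Icc 1 x, ∑ p ∈ y.primesLE, (n.factorization p : ℝ) * Real.log p := by
        apply sum_le_sum
        intro n hn
        split_ifs with h
        · refine (log_eq_sum n y ?_).le
          intro p hp
          have hpp := Nat.prime_of_mem_primeFactors hp
          refine Nat.mem_primesLE.mpr ⟨(le_gpf (by have := mem_Icc.mp hn; omega) hpp (Nat.dvd_of_mem_primeFactors hp)).trans h, hpp⟩
        · exact sum_nonneg fun p _ => mul_nonneg (Nat.cast_nonneg _) (Real.log_natCast_nonneg p)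
    _ = ∑ p ∈ y.primesLE, (x.factorial.factorization p : ℝ) * Real.log p := by
        rw [sum_comm]
        apply sum_congr rfl
        intro p _
        rw [← sum_mul, ← sum_factorization]; push_cast; rfl
    _ ≤ ∑ p ∈ y.primesLE, 2 * x * (Real.log p / p) := by
        apply sum_le_sum
        intro p hp
        obtain ⟨hpy, hpp⟩ := Nat.mem_primesLE.mp hp
        have hp2 : (2:ℝ) ≤ p := by exact_mod_cast hpp.two_le
        have h1 : (x.factorial.factorization p : ℝ) ≤ x / (p - 1) := by
          have := Nat.factorization_factorial_le_div_pred hpp x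
          calc (x.factorial.factorization p : ℝ) ≤ ((x / (p - 1) : ℕ) : ℝ) := by exact_mod_cast this
            _ ≤ (x:ℝ) / ((p - 1 : ℕ) : ℝ) := Nat.cast_div_le
            _ = _ := by rw [Nat.cast_sub hpp.one_le]; simp
        have h2 : (x:ℝ) / (p - 1) ≤ 2 * x / p := by
          rw [div_le_div_iff₀ (by linarith) (by linarith)]
          nlinarith [(Nat.cast_nonneg x : (0:ℝ) ≤ x)]
        have hl : 0 ≤ Real.log p := Real.log_natCast_nonneg p
        calc _ ≤ (2 * x / p) * Real.log p := by gcongr; linarith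
          _ = _ := by ring
    _ ≤ 2 * x * (2 * Real.log y) := by
        rw [← mul_sum]
        gcongr
        exact mertens_le y hy
    _ = _ := by ring

theorem smooth_count (x y : ℕ) (hy : 1 ≤ y) (hx : 2 ≤ x) :
    ∑ n ∈ Icc 1 x, (if gpf n ≤ y then (1:ℝ) else 0) ≤ Real.sqrt x + 8 * x * Real.log y / Real.log x := by
  have hx1 : (1:ℝ) < x := by exact_mod_cast hx
  have hlx : 0 < Real.log x := Real.log_pos hx1
  have h : ∀ n ∈ Icc 1 x, (if gpf n ≤ y then (1:ℝ) else 0) ≤ (if n ≤ Nat.sqrt x then 1 else 0) + (2 / Real.log x) * (if gpf n ≤ y then Real.log n else 0) := by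
    intro n hn
    have hln : 0 ≤ Real.log n := Real.log_natCast_nonneg n
    have hn1 := (mem_Icc.mp hn).1
    by_cases h1 : gpf n ≤ y <;> by_cases h2 : n ≤ Nat.sqrt x <;> simp only [h1, h2, if_true, if_false]
    · have : 0 ≤ 2 / Real.log x * Real.log n := by positivity
      linarith
    · rw [zero_add]
      have h3 : x < n * n := Nat.sqrt_lt.mp (by omega)
      have h4 : Real.log x ≤ 2 * Real.log n := by
        have : Real.log x ≤ Real.log ((n:ℝ) * n) := Real.log_le_log (by linarith) (by exact_mod_cast h3.le)
        rw [Real.log_mul (by positivity) (by positivity)] at this; linarith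
      rw [div_mul_eq_mul_div, le_div_iff₀ hlx]; linarith
    · simp
    · simp
  refine (sum_le_sum h).trans ?_
  rw [sum_add_distrib, ← mul_sum]
  apply add_le_add
  · rw [← sum_filter, sum_const, nsmul_eq_mul, mul_one]
    have : (Icc 1 x).filter (fun n => n ≤ Nat.sqrt x) ⊆ Icc 1 (Nat.sqrt x) := by
      intro n; simp; omega
    have := card_le_card this
    rw [Nat.card_Icc, Nat.add_sub_cancel] at this
    calc _ ≤ ((Nat.sqrt x : ℕ) : ℝ) := by exact_mod_cast this
      _ ≤ _ := Real.nat_sqrt_le_real_sqrt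
  · calc _ ≤ (2 / Real.log x) * (4 * x * Real.log y) := by
          gcongr; exact smooth_log x y hy
      _ = _ := by ring

/-- discrepancy weight. -/
noncomputable def Ew (S : Set ℕ) (δ : ℝ) (p : ℕ) : ℝ :=
  (if p ∈ S then 1 else 0) - δ * (if p.Prime then 1 else 0)

/-- discrepancy sum. -/
noncomputable def Rw (S : Set ℕ) (δ : ℝ) (n : ℕ) : ℝ := ∑ p ∈ Icc 1 n, Ew S δ p

theorem Rw_small (S : Set ℕ) (hS : ∀ p ∈ S, Nat.Prime p) (δ : ℝ)
    (hdens : Tendsto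
      (fun x : ℕ => (((Finset.range (x + 1)).filter (fun p => p ∈ S)).card : ℝ) /
        (Nat.primeCounting x : ℝ)) atTop (nhds δ)) (η : ℝ) (hη : 0 < η) :
    ∃ Q : ℕ, ∀ n, Q ≤ n → |Rw S δ n| ≤ η * (Nat.primeCounting n : ℝ) := by
  have h1 := (hdens.sub_const δ).abs.eventually (ge_mem_nhds (show |δ - δ| < η by simpa using hη))
  obtain ⟨Q, hQ⟩ := eventually_atTop.mp (h1.and (eventually_ge_atTop 2))
  refine ⟨Q, fun n hn => ?_⟩
  obtain ⟨h2, h3⟩ := hQ n hn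
  have hpi : (0:ℝ) < (Nat.primeCounting n : ℝ) := by
    have : Nat.primeCounting n ≠ 0 := by rw [ne_eq, Nat.primeCounting_eq_zero_iff]; omega
    positivity
  have e1 : ((((Finset.range (n + 1)).filter (fun p => p ∈ S)).card : ℕ) : ℝ) = ∑ p ∈ Icc 1 n, if p ∈ S then (1:ℝ) else 0 := by
    rw [← sum_filter, sum_const, nsmul_eq_mul, mul_one]
    congr 2
    ext p
    simp only [mem_filter, mem_range, mem_Icc]
    constructor
    · rintro ⟨h, h'⟩; exact ⟨⟨(hS p h').pos, by omega⟩, h'⟩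
    · rintro ⟨h, h'⟩; exact ⟨by omega, h'⟩
  have e2 : (Nat.primeCounting n : ℝ) = ∑ p ∈ Icc 1 n, if p.Prime then (1:ℝ) else 0 := by
    rw [← sum_filter, sum_const, nsmul_eq_mul, mul_one, ← Nat.primesLE_card_eq_primeCounting, Nat.primesLE_eq_filter_Icc_one]
  have e3 : Rw S δ n = (((((Finset.range (n + 1)).filter (fun p => p ∈ S)).card : ℕ) : ℝ) / (Nat.primeCounting n : ℝ) - δ) * (Nat.primeCounting n : ℝ) := by
    rw [sub_mul, div_mul_cancel₀ _ hpi.ne', e1, e2, mul_sum, ← sum_sub_distrib]; rfl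
  rw [e3, abs_mul, abs_of_pos hpi]
  gcongr

theorem gpf_mul {p m : ℕ} (hp : p.Prime) (hm : 1 ≤ m) : gpf (p * m) = p ↔ gpf m ≤ p := by
  have hpm : p * m ≠ 0 := by have := hp.pos; positivity
  have h : gpf (p * m) = max p (gpf m) := by
    unfold gpf
    rw [Nat.primeFactors_mul hp.ne_zero (by omega), sup_union, hp.primeFactors]
    simp
  rw [h]; simp

theorem reindex (S : Set ℕ) (hS : ∀ p ∈ S, Nat.Prime p) (δ : ℝ) (x y : ℕ) :
    ∑ n ∈ Icc 1 x, (if y < gpf n then Ew S δ (gpf n) else 0) =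
    ∑ m ∈ Icc 1 x, ∑ p ∈ Ioc (max y (gpf m - 1)) (x / m), Ew S δ p := by
  have hE : ∀ p, ¬ p.Prime → Ew S δ p = 0 := by
    intro p hp
    have : p ∉ S := fun h => hp (hS p h)
    simp [Ew, hp, this]
  have h1 : ∀ n ∈ Icc 1 x, (if y < gpf n then Ew S δ (gpf n) else 0) =
      ∑ p ∈ Ioc y x, if p ∣ n then (if gpf n = p then Ew S δ p else 0) else 0 := by
    intro n hn
    obtain ⟨hn1, hn2⟩ := mem_Icc.mp hn
    rcases Nat.lt_or_ge n 2 with h | hn'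
    · obtain rfl : n = 1 := by omega
      rw [gpf_one, if_neg (by omega)]
      symm; apply sum_eq_zero
      intro p hp
      have := (mem_Ioc.mp hp).1
      rw [if_neg (by omega : ¬ 0 = p)]; simp
    have hd := gpf_dvd hn'
    split_ifs with h
    · rw [sum_eq_single (gpf n)]
      · simp [hd]
      · intro p _ hne
        rw [if_neg hne.symm]; simp
      · intro hne
        exact absurd (mem_Ioc.mpr ⟨h, (Nat.le_of_dvd (by omega) hd).trans hn2⟩) hne
    · symm; apply sum_eq_zero
      intro p hp
      have := (mem_Ioc.mp hp).1
      rw [if_neg (by omega : ¬ gpf n = p)]; simp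
  rw [sum_congr rfl h1, sum_comm]
  have h2 : ∀ p ∈ Ioc y x, ∑ n ∈ Icc 1 x, (if p ∣ n then (if gpf n = p then Ew S δ p else 0) else 0) =
      ∑ m ∈ Icc 1 x, if gpf m ≤ p ∧ p ≤ x / m then Ew S δ p else 0 := by
    intro p hp
    by_cases hpp : p.Prime
    · rw [sum_multiples _ p x hpp.pos]
      have : ∀ m ∈ Icc 1 (x / p), (if gpf (p * m) = p then Ew S δ p else 0) = if gpf m ≤ p ∧ p ≤ x / m then Ew S δ p else 0 := by
        intro m hm
        obtain ⟨hm1, hm2⟩ := mem_Icc.mp hm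
        have : p ≤ x / m := by
          rw [Nat.le_div_iff_mul_le hpp.pos] at hm2
          rw [Nat.le_div_iff_mul_le hm1]; linarith
        simp [gpf_mul hpp hm1, this]
      rw [sum_congr rfl this]
      apply sum_subset (Icc_subset_Icc_right (Nat.div_le_self _ _))
      intro m hm hm'
      obtain ⟨hm1, hm2⟩ := mem_Icc.mp hm
      rw [if_neg]
      rintro ⟨_, h⟩
      apply hm'
      rw [Nat.le_div_iff_mul_le hm1] at h
      rw [mem_Icc, Nat.le_div_iff_mul_le hpp.pos]
      exact ⟨hm1, by linarith⟩
    · simp [hE p hpp]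
  rw [sum_congr rfl h2, sum_comm]
  apply sum_congr rfl
  intro m hm
  obtain ⟨hm1, hm2⟩ := mem_Icc.mp hm
  rw [← sum_filter]
  apply sum_congr _ (fun _ _ => rfl)
  have h3 : x / m ≤ x := Nat.div_le_self _ _
  generalize x / m = B at *
  ext p
  simp only [mem_filter, mem_Ioc]
  omega

theorem inner_bound (S : Set ℕ) (δ η : ℝ) (Q : ℕ) (hη : 0 < η)
    (hQ : ∀ n, Q ≤ n → |Rw S δ n| ≤ η * (Nat.primeCounting n : ℝ)) (A B : ℕ) (hA : Q ≤ A) :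
    |∑ p ∈ Ioc A B, Ew S δ p| ≤ if A < B then 2 * η * (Nat.primeCounting B : ℝ) else 0 := by
  split_ifs with h
  · have : ∑ p ∈ Ioc A B, Ew S δ p = Rw S δ B - Rw S δ A := by
      unfold Rw
      rw [← sum_sdiff_eq_sub (Icc_subset_Icc_right h.le)]
      apply sum_congr _ (fun _ _ => rfl)
      ext p; simp; omega
    rw [this]
    have h1 := hQ A hA
    have h2 := hQ B (by omega)
    have h3 : (Nat.primeCounting A : ℝ) ≤ Nat.primeCounting B := by exact_mod_cast Nat.monotone_primeCounting h.le
    have := abs_sub (Rw S δ B) (Rw S δ A)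
    nlinarith
  · rw [Ioc_eq_empty h]; simp
end smooth

section wsum
open Finset Filter
open scoped Classical

theorem Ew_abs_le (S : Set ℕ) (δ : ℝ) (p : ℕ) : |Ew S δ p| ≤ 1 + |δ| := by
  unfold Ew
  refine (abs_sub _ _).trans (add_le_add ?_ ?_)
  · split_ifs <;> simp
  · split_ifs <;> simp

theorem main_bound (S : Set ℕ) (hS : ∀ p ∈ S, Nat.Prime p) (δ η C : ℝ) (Q : ℕ) (hη : 0 < η) (hC : 0 < C)
    (hQ : ∀ n, Q ≤ n → |Rw S δ n| ≤ η * (Nat.primeCounting n : ℝ))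
    (hQ2 : ∀ n : ℕ, Q ≤ n → (Nat.primeCounting n : ℝ) ≤ C * n / Real.log n)
    (k : ℕ) (hk : 0 < k) (x y : ℕ) (hx : 3 ≤ x) (hy : 1 ≤ y) (hyQ : Q ≤ y)
    (hy1 : Real.log y ≤ Real.log x / k) (hy2 : Real.log x / k ≤ Real.log (y + 1)) :
    |∑ n ∈ Icc 1 x, Ew S δ (gpf n)| ≤ (1 + |δ|) * Real.sqrt x + (1 + |δ|) * 8 / k * x + 4 * η * C * k * x := by
  have hx3 : (3:ℝ) ≤ x := by exact_mod_cast hx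
  have hlx : 1 ≤ Real.log x := by
    rw [Real.le_log_iff_exp_le (by linarith)]
    have := Real.exp_one_lt_d9
    linarith
  have hk0 : (0:ℝ) < k := by exact_mod_cast hk
  have hsplit : ∑ n ∈ Icc 1 x, Ew S δ (gpf n) = ∑ n ∈ Icc 1 x, (if gpf n ≤ y then Ew S δ (gpf n) else 0) + ∑ n ∈ Icc 1 x, (if y < gpf n then Ew S δ (gpf n) else 0) := by
    rw [← sum_add_distrib]
    apply sum_congr rfl
    intro n _
    by_cases h : gpf n ≤ y
    · rw [if_pos h, if_neg (by omega)]; simp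
    · rw [if_neg h, if_pos (by omega)]; simp
  have b1 : |∑ n ∈ Icc 1 x, (if gpf n ≤ y then Ew S δ (gpf n) else 0)| ≤ (1 + |δ|) * Real.sqrt x + (1 + |δ|) * 8 / k * x := by
    calc _ ≤ ∑ n ∈ Icc 1 x, |if gpf n ≤ y then Ew S δ (gpf n) else 0| := abs_sum_le_sum_abs _ _
      _ ≤ ∑ n ∈ Icc 1 x, (1 + |δ|) * (if gpf n ≤ y then (1:ℝ) else 0) := by
          apply sum_le_sum
          intro n _
          split_ifs
          · rw [mul_one]; exact Ew_abs_le _ _ _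
          · simp
      _ ≤ (1 + |δ|) * (Real.sqrt x + 8 * x * Real.log y / Real.log x) := by
          rw [← mul_sum]
          gcongr
          exact smooth_count x y hy (by omega)
      _ ≤ (1 + |δ|) * (Real.sqrt x + 8 * x * (Real.log x / k) / Real.log x) := by gcongr
      _ = _ := by field_simp
  have b2 : |∑ n ∈ Icc 1 x, (if y < gpf n then Ew S δ (gpf n) else 0)| ≤ 4 * η * C * k * x := by
    rw [reindex S hS]
    calc _ ≤ ∑ m ∈ Icc 1 x, |∑ p ∈ Ioc (max y (gpf m - 1)) (x / m), Ew S δ p| := abs_sum_le_sum_abs _ _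
      _ ≤ ∑ m ∈ Icc 1 x, (2 * η * C * k * x / Real.log x) * (m:ℝ)⁻¹ := by
          apply sum_le_sum
          intro m hm
          have hm1 := (mem_Icc.mp hm).1
          have hm0 : (0:ℝ) < m := by exact_mod_cast hm1
          refine (inner_bound S δ η Q hη hQ _ _ (hyQ.trans (le_max_left _ _))).trans ?_
          split_ifs with h
          · have hyB : y < x / m := (le_max_left _ _).trans_lt h
            have hB : ((x / m : ℕ) : ℝ) ≤ x / m := Nat.cast_div_le
            have hpi := hQ2 (x / m) (hyQ.trans hyB.le)
            set B := x / m
            have hlB : Real.log x / k ≤ Real.log B := by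
              refine hy2.trans (Real.log_le_log (by positivity) ?_)
              exact_mod_cast hyB
            have hl0 : 0 < Real.log x / k := by positivity
            calc 2 * η * (Nat.primeCounting B : ℝ) ≤ 2 * η * (C * B / Real.log B) := by gcongr
              _ ≤ 2 * η * (C * (x / m) / (Real.log x / k)) := by gcongr
              _ = _ := by field_simp
          · positivity
      _ = (2 * η * C * k * x / Real.log x) * ∑ m ∈ Icc 1 x, (m:ℝ)⁻¹ := by rw [mul_sum]
      _ ≤ (2 * η * C * k * x / Real.log x) * (2 * Real.log x) := by
          gcongr
          have h1 := harmonic_le_one_add_log x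
          rw [harmonic_eq_sum_Icc] at h1
          push_cast at h1
          linarith
      _ = _ := by field_simp; ring
  rw [hsplit]
  have := abs_add_le (∑ n ∈ Icc 1 x, (if gpf n ≤ y then Ew S δ (gpf n) else 0)) (∑ n ∈ Icc 1 x, (if y < gpf n then Ew S δ (gpf n) else 0))
  linarith

theorem Ew_tendsto (S : Set ℕ) (hS : ∀ p ∈ S, Nat.Prime p) (δ : ℝ)
    (hdens : Tendsto
      (fun x : ℕ => (((Finset.range (x + 1)).filter (fun p => p ∈ S)).card : ℝ) /
        (Nat.primeCounting x : ℝ)) atTop (nhds δ)) :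
    Tendsto (fun x : ℕ => (∑ n ∈ Icc 1 x, Ew S δ (gpf n)) / x) atTop (nhds 0) := by
  rw [Metric.tendsto_nhds]
  intro ε hε
  have hD : 0 < 1 + |δ| := by positivity
  obtain ⟨k, hk⟩ := exists_nat_gt (max 1 ((1 + |δ|) * 8 / (ε / 4)))
  have hk1 : (1:ℝ) < k := (le_max_left _ _).trans_lt hk
  have hk0 : 0 < k := by
    have : (0:ℝ) < k := by linarith
    exact_mod_cast this
  have hk0' : (0:ℝ) < k := by linarith
  have hk2 : (1 + |δ|) * 8 / k < ε / 4 := by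
    have := (le_max_right _ _).trans_lt hk
    rw [div_lt_iff₀ (by positivity)] at this
    rw [div_lt_iff₀ hk0']; linarith
  set C := Real.log 4 + 1 with hCd
  have hC : 0 < C := by have := Real.log_pos (show (1:ℝ) < 4 by norm_num); linarith
  set η := ε / 4 / (4 * C * k) with hηd
  have hη : 0 < η := by positivity
  have hη1 : 4 * η * C * k = ε / 4 := by rw [hηd]; field_simp
  obtain ⟨Q₁, hQ₁⟩ := Rw_small S hS δ hdens η hη
  have hch := (tendsto_natCast_atTop_atTop (R := ℝ)).eventually (Chebyshev.eventually_primeCounting_le one_pos)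
  obtain ⟨Q₂, hQ₂⟩ := eventually_atTop.mp hch
  have hpow : Tendsto (fun x : ℕ => (x:ℝ) ^ ((1:ℝ) / k)) atTop atTop :=
    (tendsto_rpow_atTop (by positivity)).comp tendsto_natCast_atTop_atTop
  have hsq : Tendsto (fun x : ℕ => Real.sqrt x) atTop atTop :=
    Real.tendsto_sqrt_atTop.comp tendsto_natCast_atTop_atTop
  filter_upwards [eventually_ge_atTop 3, hpow.eventually_ge_atTop ((max 1 (max Q₁ Q₂) : ℕ) : ℝ), hsq.eventually_ge_atTop ((1 + |δ|) / (ε / 4))] with x hx hxp hxs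
  have hx0 : (0:ℝ) < x := by positivity
  set y := ⌊(x:ℝ) ^ ((1:ℝ) / k)⌋₊ with hy
  have hyle : max 1 (max Q₁ Q₂) ≤ y := Nat.le_floor hxp
  have hy1 : 1 ≤ y := (le_max_left _ _).trans hyle
  have hlog : Real.log ((x:ℝ) ^ ((1:ℝ) / k)) = Real.log x / k := by
    rw [Real.log_rpow hx0]; ring
  have hb := main_bound S hS δ η C (max Q₁ Q₂) hη hC (fun n hn => hQ₁ n ((le_max_left _ _).trans hn))
    (fun n hn => by simpa using hQ₂ n ((le_max_right _ _).trans hn)) k hk0 x y hx hy1 ((le_max_right _ _).trans hyle)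
    (by
      rw [← hlog]
      exact Real.log_le_log (by exact_mod_cast hy1) (Nat.floor_le (by positivity)))
    (by
      rw [← hlog]
      exact Real.log_le_log (by positivity) (Nat.lt_floor_add_one _).le)
  rw [Real.dist_0_eq_abs, abs_div, abs_of_pos hx0, div_lt_iff₀ hx0]
  refine hb.trans_lt ?_
  rw [hη1]
  have hs : (1 + |δ|) * Real.sqrt x ≤ ε / 4 * x := by
    rw [div_le_iff₀ (by positivity)] at hxs
    have h1 : (x:ℝ) = Real.sqrt x * Real.sqrt x := (Real.mul_self_sqrt hx0.le).symm
    calc _ ≤ (Real.sqrt x * (ε / 4)) * Real.sqrt x := by gcongr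
      _ = ε / 4 * (Real.sqrt x * Real.sqrt x) := by ring
      _ = _ := by rw [← h1]
  nlinarith

theorem W_tendsto (S : Set ℕ) (hS : ∀ p ∈ S, Nat.Prime p) (δ : ℝ)
    (hdens : Tendsto
      (fun x : ℕ => (((Finset.range (x + 1)).filter (fun p => p ∈ S)).card : ℝ) /
        (Nat.primeCounting x : ℝ)) atTop (nhds δ)) :
    Tendsto (fun x : ℕ => W S x / x) atTop (nhds δ) := by
  have h0S : 0 ∉ S := fun h => Nat.not_prime_zero (hS 0 h)
  have h1 : Tendsto (fun x : ℕ => δ - δ * (1 / (x:ℝ))) atTop (nhds (δ - δ * 0)) :=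
    (tendsto_one_div_atTop_nhds_zero_nat.const_mul δ).const_sub δ
  have h2 := (Ew_tendsto S hS δ hdens).add h1
  rw [mul_zero, sub_zero, zero_add] at h2
  refine h2.congr' ?_
  filter_upwards [eventually_ge_atTop 1] with x hx
  have hx0 : (x:ℝ) ≠ 0 := by positivity
  have : W S x = ∑ n ∈ Icc 1 x, Ew S δ (gpf n) + δ * (x - 1) := by
    have e : ∀ n ∈ Icc 1 x, (if gpf n ∈ S then (1:ℝ) else 0) = Ew S δ (gpf n) + (δ - if n = 1 then δ else 0) := by
      intro n hn
      have hn1 := (mem_Icc.mp hn).1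
      by_cases h : n = 1
      · subst h; simp [gpf_one, Ew, h0S, Nat.not_prime_zero]
      · have := gpf_prime (show 2 ≤ n by omega)
        simp [Ew, this, h]
    unfold W
    rw [sum_congr rfl e, sum_add_distrib, sum_sub_distrib]
    simp [hx]
    ring
  rw [this]
  field_simp
end wsum

section final
open Finset Filter
open scoped Classical

theorem alladi_basic (S : Set ℕ) (hS : ∀ p ∈ S, Nat.Prime p) (δ : ℝ)
    (hdens : Tendsto
      (fun x : ℕ => (((Finset.range (x + 1)).filter (fun p => p ∈ S)).card : ℝ) /
        (Nat.primeCounting x : ℝ)) atTop (nhds δ)) :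
    Tendsto (fun x : ℕ => ∑ n ∈ Icc 1 x, cS S n / n) atTop (nhds (-δ)) :=
  alladi_of_W S hS δ (W_tendsto S hS δ hdens)

/-- primes that are large or in `S`. -/
def Am (S : Set ℕ) (q : ℕ) : Set ℕ := {p | p.Prime ∧ (q ≤ p ∨ p ∈ S)}

theorem Am_prime (S : Set ℕ) (q : ℕ) : ∀ p ∈ Am S q, Nat.Prime p := fun _ h => h.1

theorem Am_dens (S : Set ℕ) (q : ℕ) : Tendsto
      (fun x : ℕ => (((Finset.range (x + 1)).filter (fun p => p ∈ Am S q)).card : ℝ) /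
        (Nat.primeCounting x : ℝ)) atTop (nhds 1) := by
  have hpi : Tendsto (fun x : ℕ => (Nat.primeCounting x : ℝ)) atTop atTop :=
    tendsto_natCast_atTop_atTop.comp Nat.tendsto_primeCounting
  have hlow : Tendsto (fun x : ℕ => 1 - (q:ℝ) / (Nat.primeCounting x : ℝ)) atTop (nhds 1) := by
    have := (hpi.const_div_atTop (q:ℝ)).const_sub 1
    rwa [sub_zero] at this
  refine tendsto_of_tendsto_of_tendsto_of_le_of_le' hlow tendsto_const_nhds ?_ ?_
  · filter_upwards [hpi.eventually_gt_atTop 0] with x hx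
    rw [le_div_iff₀ hx, sub_mul, div_mul_cancel₀ _ hx.ne', one_mul]
    have h : x.primesLE ⊆ (range (x+1)).filter (fun p => p ∈ Am S q) ∪ range q := by
      intro p hp
      obtain ⟨h1, h2⟩ := Nat.mem_primesLE.mp hp
      simp only [mem_union, mem_filter, mem_range]
      by_cases h3 : p < q
      · exact Or.inr h3
      · exact Or.inl ⟨by omega, h2, Or.inl (by omega)⟩
    have h1 := (card_le_card h).trans (card_union_le _ _)
    rw [Nat.primesLE_card_eq_primeCounting, card_range] at h1
    have : (Nat.primeCounting x : ℝ) ≤ (((range (x+1)).filter (fun p => p ∈ Am S q)).card : ℝ) + q := by exact_mod_cast h1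
    linarith
  · filter_upwards [hpi.eventually_gt_atTop 0] with x hx
    rw [div_le_one hx, ← Nat.primesLE_card_eq_primeCounting]
    have : (range (x+1)).filter (fun p => p ∈ Am S q) ⊆ x.primesLE := by
      intro p hp
      simp only [mem_filter, mem_range] at hp
      exact Nat.mem_primesLE.mpr ⟨by omega, hp.2.1⟩
    exact_mod_cast card_le_card this

/-- inner sum. -/
noncomputable def Tm (S : Set ℕ) (m y : ℕ) : ℝ :=
  ∑ d ∈ Icc 1 y, (if (m * d).minFac ∈ S then mu d else 0) / d

theorem minFac_mul {m d : ℕ} (hm : 2 ≤ m) (hd : 2 ≤ d) : (m * d).minFac = min m.minFac d.minFac := by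
  have hm' : m.minFac.Prime := Nat.minFac_prime (by omega)
  have hd' : d.minFac.Prime := Nat.minFac_prime (by omega)
  apply le_antisymm
  · exact le_min (Nat.minFac_le_of_dvd hm'.two_le ((Nat.minFac_dvd m).trans (dvd_mul_right _ _)))
      (Nat.minFac_le_of_dvd hd'.two_le ((Nat.minFac_dvd d).trans (dvd_mul_left _ _)))
  · have hq : (m * d).minFac.Prime := Nat.minFac_prime (by nlinarith)
    rcases (Nat.Prime.dvd_mul hq).mp (Nat.minFac_dvd (m * d)) with h | h
    · exact (min_le_left _ _).trans (Nat.minFac_le_of_dvd hq.two_le h)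
    · exact (min_le_right _ _).trans (Nat.minFac_le_of_dvd hq.two_le h)

theorem Tm_one (S : Set ℕ) (y : ℕ) : Tm S 1 y = ∑ d ∈ Icc 1 y, cS S d / d := by
  simp [Tm, cS]

theorem Tm_eq (S : Set ℕ) (m y : ℕ) (hm : 2 ≤ m) (hmS : m.minFac ∈ S) (hy : 1 ≤ y) :
    Tm S m y = 1 + ∑ d ∈ Icc 1 y, cS (Am S m.minFac) d / d := by
  have e : ∀ d ∈ Icc 1 y, (if (m * d).minFac ∈ S then mu d else 0) / (d:ℝ) =
      (if d = 1 then 1 else 0) + cS (Am S m.minFac) d / d := by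
    intro d hd
    have hd1 := (mem_Icc.mp hd).1
    by_cases h : d = 1
    · subst h
      have : 1 ∉ Am S m.minFac := fun h => Nat.not_prime_one h.1
      simp [hmS, cS, this, mu]
    · have hd' : d.minFac.Prime := Nat.minFac_prime h
      have : (m * d).minFac ∈ S ↔ d.minFac ∈ Am S m.minFac := by
        rw [minFac_mul hm (by omega)]
        rcases le_or_gt m.minFac d.minFac with h1 | h1
        · rw [min_eq_left h1]
          exact ⟨fun _ => ⟨hd', Or.inl h1⟩, fun _ => hmS⟩
        · rw [min_eq_right h1.le]
          exact ⟨fun h => ⟨hd', Or.inr h⟩, fun h => h.2.resolve_left (by omega)⟩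
      simp [h, cS, this]
  unfold Tm
  rw [sum_congr rfl e, sum_add_distrib]
  simp [hy]

theorem Tm_bound (S : Set ℕ) (hS : ∀ p ∈ S, Nat.Prime p) (m y : ℕ) (h : m = 1 ∨ (2 ≤ m ∧ m.minFac ∈ S)) :
    |Tm S m y| ≤ 3 := by
  rcases h with rfl | ⟨h1, h2⟩
  · rw [Tm_one]
    have := sum_bound S hS y
    linarith
  · rcases Nat.eq_zero_or_pos y with rfl | hy
    · simp [Tm]
    · rw [Tm_eq S m y h1 h2 hy]
      have := sum_bound (Am S m.minFac) (Am_prime _ _) y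
      have := abs_add_le 1 (∑ d ∈ Icc 1 y, cS (Am S m.minFac) d / d)
      rw [abs_one] at this
      linarith

theorem Tm_tendsto (S : Set ℕ) (m : ℕ) (hm : 2 ≤ m) (hmS : m.minFac ∈ S) :
    Tendsto (Tm S m) atTop (nhds 0) := by
  have := (alladi_basic (Am S m.minFac) (Am_prime _ _) 1 (Am_dens S _)).const_add 1
  rw [show (1:ℝ) + -1 = 0 by norm_num] at this
  refine this.congr' ?_
  filter_upwards [eventually_ge_atTop 1] with y hy
  rw [Tm_eq S m y hm hmS hy]

theorem sum_reindex (S : Set ℕ) (hS : ∀ p ∈ S, Nat.Prime p) (a : ℕ → ℂ) (x : ℕ) :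
    ∑ n ∈ Icc 2 x,
          (if n.minFac ∈ S then
            (∑ d ∈ n.divisors, (ArithmeticFunction.moebius d : ℂ) * a (n / d)) / (n:ℂ)
          else 0) = ∑ m ∈ Icc 1 x, a m / m * ((Tm S m (x / m) : ℝ) : ℂ) := by
  have h1S : 1 ∉ S := fun h => Nat.not_prime_one (hS 1 h)
  have h1 : ∑ n ∈ Icc 2 x,
          (if n.minFac ∈ S then
            (∑ d ∈ n.divisors, (ArithmeticFunction.moebius d : ℂ) * a (n / d)) / (n:ℂ)
          else 0) = ∑ n ∈ Icc 1 x,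
          (if n.minFac ∈ S then
            (∑ d ∈ n.divisors, (ArithmeticFunction.moebius d : ℂ) * a (n / d)) / (n:ℂ)
          else 0) := by
    apply sum_subset (Icc_subset_Icc_left (by norm_num))
    intro n hn hn'
    obtain rfl : n = 1 := by simp only [mem_Icc] at hn hn'; omega
    simp [h1S]
  have h2 : ∀ n ∈ Icc 1 x, (if n.minFac ∈ S then
            (∑ d ∈ n.divisors, (ArithmeticFunction.moebius d : ℂ) * a (n / d)) / (n:ℂ)
          else 0) = ∑ m ∈ Icc 1 x, if m ∣ n then (if n.minFac ∈ S then (ArithmeticFunction.moebius (n / m) : ℂ) * a m / n else 0) else 0 := by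
    intro n hn
    obtain ⟨hn1, hn2⟩ := mem_Icc.mp hn
    have e : n.divisors = (Icc 1 x).filter (fun m => m ∣ n) := by
      ext d
      simp only [mem_filter, mem_Icc, Nat.mem_divisors]
      constructor
      · rintro ⟨h, _⟩
        exact ⟨⟨Nat.pos_of_dvd_of_pos h hn1, (Nat.le_of_dvd hn1 h).trans hn2⟩, h⟩
      · rintro ⟨_, h⟩; exact ⟨h, by omega⟩
    rw [← sum_filter, ← e]
    by_cases h : n.minFac ∈ S
    · simp only [h, if_true]
      rw [← sum_div]
      congr 1
      rw [← Nat.sum_div_divisors n (fun d => (ArithmeticFunction.moebius d : ℂ) * a (n / d))]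
      apply sum_congr rfl
      intro d hd
      rw [Nat.div_div_self (Nat.dvd_of_mem_divisors hd) (by omega)]
    · simp [h]
  rw [h1, sum_congr rfl h2, sum_comm]
  apply sum_congr rfl
  intro m hm
  have hm1 := (mem_Icc.mp hm).1
  rw [sum_multiples (fun n => if n.minFac ∈ S then (ArithmeticFunction.moebius (n / m) : ℂ) * a m / n else 0) m x hm1]
  unfold Tm
  push_cast
  rw [mul_sum]
  apply sum_congr rfl
  intro d hd
  rw [Nat.mul_div_cancel_left d hm1]
  split_ifs with h
  · unfold mu
    push_cast
    field_simp
  · simp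

theorem summable_a (S : Set ℕ) (a : ℕ → ℂ) 
    (hsupp : ∀ n : ℕ, 2 ≤ n → n.minFac ∉ S → a n = 0)
    (hsum : Summable (fun n : ℕ =>
      if 2 ≤ n ∧ n.minFac ∈ S then ‖a n‖ * Real.log (Real.log n) / n else 0)) :
    Summable (fun n : ℕ => ‖a n‖ / n) := by
  refine Summable.of_norm_bounded_eventually_nat hsum ?_
  filter_upwards [eventually_ge_atTop 16] with n hn
  have hn0 : (16:ℝ) ≤ n := by exact_mod_cast hn
  rw [Real.norm_of_nonneg (by positivity)]
  by_cases h : n.minFac ∈ S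
  · rw [if_pos ⟨by omega, h⟩]
    have h1 : Real.exp 1 ≤ Real.log n := by
      have h2 : Real.log 16 ≤ Real.log n := Real.log_le_log (by norm_num) hn0
      have h3 : Real.log 16 = 4 * Real.log 2 := by
        rw [show (16:ℝ) = 2 ^ 4 by norm_num, Real.log_pow]; norm_num
      have := Real.log_two_gt_d9
      have := Real.exp_one_lt_d9
      linarith
    have h2 : 1 ≤ Real.log (Real.log n) := by
      rw [Real.le_log_iff_exp_le (lt_of_lt_of_le (Real.exp_pos _) h1)]; exact h1
    gcongr
    nlinarith [norm_nonneg (a n)]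
  · rw [if_neg (fun h' => h h'.2), hsupp n (by omega) h]; simp
end final
end AL

open scoped Classical
open Finset Filter

/-- Wang's convolution version of Alladi's formula over ℚ: if `S` has natural density `δ`,
`a(1) = 1`, `a` is supported on `{1} ∪ {n ≥ 2 : p_min(n) ∈ S}`, and
`∑ |a(n)| log log n / n < ∞`, then
`−∑_{2 ≤ n ≤ x, p_min(n) ∈ S} (μ*a)(n)/n → δ`. -/
theorem alladi_convolution (S : Set ℕ) (hS : ∀ p ∈ S, Nat.Prime p) (δ : ℝ)
    (hdens : Tendsto
      (fun x : ℕ => (((Finset.range (x + 1)).filter (fun p => p ∈ S)).card : ℝ) /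
        (Nat.primeCounting x : ℝ)) atTop (nhds δ))
    (a : ℕ → ℂ) (ha1 : a 1 = 1)
    (hsupp : ∀ n : ℕ, 2 ≤ n → n.minFac ∉ S → a n = 0)
    (hsum : Summable (fun n : ℕ =>
      if 2 ≤ n ∧ n.minFac ∈ S then ‖a n‖ * Real.log (Real.log n) / n else 0)) :
    Tendsto
      (fun x : ℕ =>
        -∑ n ∈ Finset.Icc 2 x,
          (if n.minFac ∈ S then
            (∑ d ∈ n.divisors, (ArithmeticFunction.moebius d : ℂ) * a (n / d)) / n
          else 0))
      atTop (nhds (δ : ℂ)) := by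
  have hT : Tendsto (fun x : ℕ => ∑' m : ℕ, a m / m * ((AL.Tm S m (x / m) : ℝ) : ℂ)) atTop
      (nhds (∑' m : ℕ, if m = 1 then (-δ : ℂ) else 0)) := by
    refine tendsto_tsum_of_dominated_convergence (bound := fun m : ℕ => ‖a m‖ / m * 3)
      ((AL.summable_a S a hsupp hsum).mul_right 3) ?_ ?_
    · intro m
      rcases Nat.lt_or_ge m 2 with h | h
      · obtain rfl | rfl : m = 0 ∨ m = 1 := by omega
        · simp
        · have h1 := AL.alladi_basic S hS δ hdens
          simp only [ha1, Nat.div_one, AL.Tm_one, Nat.cast_one, div_one, one_mul, if_true]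
          have := (Complex.continuous_ofReal.tendsto _).comp h1
          simpa [Function.comp_def] using this
      · rw [if_neg (by omega)]
        by_cases hmS : m.minFac ∈ S
        · have h1 := (AL.Tm_tendsto S m h hmS).comp (Nat.tendsto_div_const_atTop (n := m) (by omega))
          have := ((Complex.continuous_ofReal.tendsto _).comp h1).const_mul (a m / m)
          simpa [Function.comp_def] using this
        · simp [hsupp m h hmS]
    · refine Eventually.of_forall fun x m => ?_
      by_cases h : m = 1 ∨ (2 ≤ m ∧ m.minFac ∈ S)
      · rw [norm_mul, norm_div, Complex.norm_natCast, Complex.norm_real, Real.norm_eq_abs]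
        gcongr
        exact AL.Tm_bound S hS m _ h
      · have : a m / (m:ℂ) = 0 := by
          rcases Nat.eq_zero_or_pos m with rfl | hm
          · simp
          · have h2 : 2 ≤ m := by
              by_contra hlt
              exact h (Or.inl (by omega))
            rw [hsupp m h2 (fun hh => h (Or.inr ⟨h2, hh⟩))]; simp
        rw [this]
        simp only [zero_mul, norm_zero]
        positivity
  rw [tsum_ite_eq] at hT
  have hN := hT.neg
  rw [neg_neg] at hN
  refine hN.congr fun x => ?_
  congr 1
  rw [AL.sum_reindex S hS a x]
  apply tsum_eq_sum
  intro m hm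
  rcases Nat.eq_zero_or_pos m with rfl | h
  · simp
  · have : x / m = 0 := by
      apply Nat.div_eq_of_lt
      by_contra hlt
      exact hm (mem_Icc.mpr ⟨h, by omega⟩)
    simp [this, AL.Tm]
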